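/- arXiv:0811.2277 — 2 statements merged into one kernel-verified Lean document; each statement's English description precedes it below -/
import Mathlib

section
/- Let Ω ⊆ ℍ be open and u : Ω → ℝ be Lipschitz with respect to the Korányi distance ρ. Let D be the set of points g ∈ Ω at which the two-sided limits Xu(g) = lim_{λ→0} (u(g·(λ,0,0)) − u(g))/λ and Yu(g) = lim_{λ→0} (u(g·(0,λ,0)) − u(g))/λ both exist, and write 𝕏u(g) = (Xu(g), Yu(g)). For a Borel set E ⊆ Ω and v ∈ ℝ² let Σ^E_v = {g ∈ E ∩ D : 𝕏u(g) = v}, and define ν_u(E) = ∫_{ℝ²} 𝓗²_ρ(Σ^E_v) dv (lower Lebesgue integral), where 𝓗²_ρ is the 2-dimensional Hausdorff measure of the metric space (ℍ, ρ). Then ν_u is nonnegative and countably additive: for every sequence (E_i)_{i∈ℕ} of pairwise disjoint Borel subsets of Ω, ν_u(⋃_i E_i) = Σ_i ν_u(E_i). -/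
noncomputable section

open Filter Topology Set
open scoped ENNReal

/-- The underlying set of the Heisenberg group `ℍ = ℝ³`, points `(x, y, t)`. -/
abbrev Hgrp : Type := ℝ × ℝ × ℝ

/-- Heisenberg group law `(x,y,t)·(x',y',t') = (x+x', y+y', t+t'+2(x'y−xy'))`. -/
def hmul (g g' : Hgrp) : Hgrp :=
  (g.1 + g'.1, g.2.1 + g'.2.1,
    g.2.2 + g'.2.2 + 2 * (g'.1 * g.2.1 - g.1 * g'.2.1))

/-- Inverse in the Heisenberg group. -/
def hinv (g : Hgrp) : Hgrp := (-g.1, -g.2.1, -g.2.2)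

/-- Anisotropic dilation `δ_λ(x,y,t) = (λx, λy, λ²t)`. -/
def hdil (l : ℝ) (g : Hgrp) : Hgrp := (l * g.1, l * g.2.1, l ^ 2 * g.2.2)

/-- Horizontal projection `ξ₁(x,y,t) = (x,y)`. -/
def xi1 (g : Hgrp) : ℝ × ℝ := (g.1, g.2.1)

/-- Exponential of a horizontal vector: `exp (a,b) = (a,b,0)`. -/
def hexp (v : ℝ × ℝ) : Hgrp := (v.1, v.2, 0)

/-- Euclidean inner product on `ℝ²`. -/
def dot (p q : ℝ × ℝ) : ℝ := p.1 * q.1 + p.2 * q.2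

/-- Euclidean norm on `ℝ²`. -/
def enorm2 (p : ℝ × ℝ) : ℝ := Real.sqrt (p.1 ^ 2 + p.2 ^ 2)

/-- The horizontal plane `H_{g₀} = {(x,y,t) : t = t₀ + 2y₀x − 2x₀y}`. -/
def hplane (g0 : Hgrp) : Set Hgrp :=
  {g | g.2.2 = g0.2.2 + 2 * g0.2.1 * g.1 - 2 * g0.1 * g.2.1}

/-- The H-subdifferential `∂_H u(g₀)` of `u : Ω → ℝ` at `g₀`. -/
def hsub (Ω : Set Hgrp) (u : Hgrp → ℝ) (g0 : Hgrp) : Set (ℝ × ℝ) :=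
  {p | ∀ g ∈ hplane g0 ∩ Ω, u g ≥ u g0 + dot p (xi1 g - xi1 g0)}

/-- The H-normal map: `∂_H u(E) = ⋃_{g ∈ E} ∂_H u(g)`. -/
def hsubSet (Ω : Set Hgrp) (u : Hgrp → ℝ) (E : Set Hgrp) : Set (ℝ × ℝ) :=
  ⋃ g ∈ E, hsub Ω u g

/-- H-convexity of a set. -/
def HConvexSet (Ω : Set Hgrp) : Prop :=
  ∀ g ∈ Ω, ∀ g' ∈ hplane g ∩ Ω, ∀ l ∈ Set.Icc (0:ℝ) 1,
    hmul g (hdil l (hmul (hinv g) g')) ∈ Ω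

/-- H-convexity (weak H-convexity) of a function on `Ω`. -/
def HConvexOn (Ω : Set Hgrp) (u : Hgrp → ℝ) : Prop :=
  ∀ g ∈ Ω, ∀ g' ∈ hplane g ∩ Ω, ∀ l ∈ Set.Icc (0:ℝ) 1,
    u (hmul g (hdil l (hmul (hinv g) g'))) ≤ u g + l * (u g' - u g)

/-- Strict H-convexity of a function on all of `ℍ`. -/
def StrictHConvexOn (u : Hgrp → ℝ) : Prop :=
  HConvexOn Set.univ u ∧
    ∀ g : Hgrp, ∀ g' ∈ hplane g, g ≠ g' → ∀ l ∈ Set.Icc (0:ℝ) 1,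
      u (hmul g (hdil l (hmul (hinv g) g'))) = u g + l * (u g' - u g) →
        l = 0 ∨ l = 1

/-- The Korányi gauge `‖(x,y,t)‖_ℍ = ((x²+y²)² + t²)^{1/4}`. -/
def kgauge (g : Hgrp) : ℝ := ((g.1 ^ 2 + g.2.1 ^ 2) ^ 2 + g.2.2 ^ 2) ^ ((1:ℝ)/4)

/-- The Korányi distance `ρ(g,g') = ‖g⁻¹·g'‖_ℍ`. -/
def kdist (g g' : Hgrp) : ℝ := kgauge (hmul (hinv g) g')

/-- A function on `ℍ` is radial if `u(x,y,t) = U(√(x²+y²), t)`. -/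
def IsRadial (u : Hgrp → ℝ) : Prop :=
  ∃ U : ℝ × ℝ → ℝ, ∀ x y t : ℝ, u (x, y, t) = U (Real.sqrt (x ^ 2 + y ^ 2), t)

/-- Horizontal derivative `Xu = ∂u/∂x + 2y ∂u/∂t`. -/
def Xd (u : Hgrp → ℝ) (g : Hgrp) : ℝ :=
  fderiv ℝ u g (1, 0, 0) + 2 * g.2.1 * fderiv ℝ u g (0, 0, 1)

/-- Horizontal derivative `Yu = ∂u/∂y − 2x ∂u/∂t`. -/
def Yd (u : Hgrp → ℝ) (g : Hgrp) : ℝ :=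
  fderiv ℝ u g (0, 1, 0) - 2 * g.1 * fderiv ℝ u g (0, 0, 1)

/-- Difference quotient of `u` at `g` in the `X` direction. -/
def XdiffQuot (u : Hgrp → ℝ) (g : Hgrp) (l : ℝ) : ℝ := (u (hmul g (l, 0, 0)) - u g) / l

/-- Difference quotient of `u` at `g` in the `Y` direction. -/
def YdiffQuot (u : Hgrp → ℝ) (g : Hgrp) (l : ℝ) : ℝ := (u (hmul g (0, l, 0)) - u g) / l

/-- Existence of the two-sided limit `Xu(g)`. -/
def XlimExists (u : Hgrp → ℝ) (g : Hgrp) : Prop :=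
  ∃ a : ℝ, Filter.Tendsto (XdiffQuot u g) (nhdsWithin 0 {0}ᶜ) (nhds a)

/-- Existence of the two-sided limit `Yu(g)`. -/
def YlimExists (u : Hgrp → ℝ) (g : Hgrp) : Prop :=
  ∃ a : ℝ, Filter.Tendsto (YdiffQuot u g) (nhdsWithin 0 {0}ᶜ) (nhds a)

/-- The value `Xu(g)` (defined via choice where the limit exists, else `0`). -/
def XuVal (u : Hgrp → ℝ) (g : Hgrp) : ℝ :=
  haveI := Classical.dec (XlimExists u g)
  if h : XlimExists u g then h.choose else 0

/-- The value `Yu(g)`. -/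
def YuVal (u : Hgrp → ℝ) (g : Hgrp) : ℝ :=
  haveI := Classical.dec (YlimExists u g)
  if h : YlimExists u g then h.choose else 0

/-- The horizontal gradient `𝕏u(g) = (Xu(g), Yu(g))`. -/
def XXgrad (u : Hgrp → ℝ) (g : Hgrp) : ℝ × ℝ := (XuVal u g, YuVal u g)

/-- The circle `C(t,R) = {(x,y,t) : x²+y² = R²}`. -/
def Ccirc (t R : ℝ) : Set Hgrp := {g | g.2.2 = t ∧ g.1 ^ 2 + g.2.1 ^ 2 = R ^ 2}

/-- A disc (open or closed) in `ℝ²` centered at the origin, of radius `R ∈ [0,∞]`. -/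
def IsCenteredDisc (S : Set (ℝ × ℝ)) : Prop :=
  ∃ R : ℝ≥0∞, S = {p : ℝ × ℝ | ENNReal.ofReal (enorm2 p) < R} ∨
    S = {p : ℝ × ℝ | ENNReal.ofReal (enorm2 p) ≤ R}

/-- Diameter of a subset of `ℍ` with respect to the Korányi distance. -/
def kdiam (S : Set Hgrp) : ℝ≥0∞ :=
  ⨆ a ∈ S, ⨆ b ∈ S, ENNReal.ofReal (kdist a b)

/-- The 2-dimensional Hausdorff (outer) measure of the metric space `(ℍ, ρ)`. -/
def kHaus2 (S : Set Hgrp) : ℝ≥0∞ :=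
  ⨆ (ε : ℝ≥0∞) (_ : 0 < ε),
    ⨅ (c : ℕ → Set Hgrp) (_ : S ⊆ ⋃ n, c n) (_ : ∀ n, kdiam (c n) ≤ ε),
      ∑' n, (kdiam (c n)) ^ 2

/-- The set `D` of points of `Ω` where both horizontal derivatives exist. -/
def Dset (Ω : Set Hgrp) (u : Hgrp → ℝ) : Set Hgrp :=
  {g ∈ Ω | XlimExists u g ∧ YlimExists u g}

/-- The level set `Σ^E_v = {g ∈ E ∩ D : 𝕏u(g) = v}`. -/
def SigmaSet (Ω : Set Hgrp) (u : Hgrp → ℝ) (E : Set Hgrp) (v : ℝ × ℝ) : Set Hgrp :=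
  {g ∈ E ∩ Dset Ω u | XXgrad u g = v}

/-- The Monge–Ampère set function `ν_u(E) = ∫_{ℝ²} 𝓗²_ρ(Σ^E_v) dv`. -/
def nuMA (Ω : Set Hgrp) (u : Hgrp → ℝ) (E : Set Hgrp) : ℝ≥0∞ :=
  ∫⁻ v : ℝ × ℝ, kHaus2 (SigmaSet Ω u E v)

open MeasureTheory

/-! ### The Korányi metric and its Hausdorff measure -/

lemma kgauge_nonneg (g : Hgrp) : 0 ≤ kgauge g := by
  unfold kgauge; positivity

lemma kgauge_sq (g : Hgrp) :
    kgauge g ^ 2 = ‖(⟨g.1 ^ 2 + g.2.1 ^ 2, g.2.2⟩ : ℂ)‖ := by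
  rw [Complex.norm_eq_sqrt_sq_add_sq, kgauge, ← Real.rpow_natCast,
    ← Real.rpow_mul (by positivity), Real.sqrt_eq_rpow]
  norm_num

lemma kgauge_pow_four (g : Hgrp) :
    kgauge g ^ 4 = (g.1 ^ 2 + g.2.1 ^ 2) ^ 2 + g.2.2 ^ 2 := by
  have h : kgauge g ^ 4 = (kgauge g ^ 2) ^ 2 := by ring
  rw [h, kgauge_sq, Complex.norm_eq_sqrt_sq_add_sq, Real.sq_sqrt (by positivity)]

lemma norm_horizontal_le_kgauge_sq (g : Hgrp) : g.1 ^ 2 + g.2.1 ^ 2 ≤ kgauge g ^ 2 := by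
  refine abs_le_of_sq_le_sq' ?_ (by positivity) |>.2
  have := kgauge_pow_four g
  nlinarith [sq_nonneg g.2.2]

lemma abs_fst_le_kgauge (g : Hgrp) : |g.1| ≤ kgauge g :=
  abs_le_of_sq_le_sq (by nlinarith [norm_horizontal_le_kgauge_sq g, sq_nonneg g.2.1])
    (kgauge_nonneg g)

lemma abs_snd_le_kgauge (g : Hgrp) : |g.2.1| ≤ kgauge g :=
  abs_le_of_sq_le_sq (by nlinarith [norm_horizontal_le_kgauge_sq g, sq_nonneg g.1])
    (kgauge_nonneg g)

lemma abs_vertical_le_kgauge_sq (g : Hgrp) : |g.2.2| ≤ kgauge g ^ 2 :=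
  abs_le_of_sq_le_sq (by nlinarith [kgauge_pow_four g, sq_nonneg (g.1 ^ 2 + g.2.1 ^ 2)])
    (by positivity)

lemma kgauge_hmul_le (g g' : Hgrp) : kgauge (hmul g g') ≤ kgauge g + kgauge g' := by
  refine abs_le_of_sq_le_sq' ?_ (add_nonneg (kgauge_nonneg g) (kgauge_nonneg g')) |>.2
  set w : ℂ := ⟨g.1 * g'.1 + g.2.1 * g'.2.1, g'.1 * g.2.1 - g.1 * g'.2.1⟩ with hw
  have hsum : (⟨(hmul g g').1 ^ 2 + (hmul g g').2.1 ^ 2, (hmul g g').2.2⟩ : ℂ)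
      = ⟨g.1 ^ 2 + g.2.1 ^ 2, g.2.2⟩ + ⟨g'.1 ^ 2 + g'.2.1 ^ 2, g'.2.2⟩ + 2 * w := by
    apply Complex.ext
    · simp [hw, hmul]; ring
    · simp [hw, hmul]
  have hwn : ‖w‖ ≤ kgauge g * kgauge g' := by
    refine abs_le_of_sq_le_sq' ?_ (mul_nonneg (kgauge_nonneg g) (kgauge_nonneg g')) |>.2
    rw [Complex.norm_eq_sqrt_sq_add_sq, Real.sq_sqrt (by positivity), mul_pow]
    calc _ = (g.1 ^ 2 + g.2.1 ^ 2) * (g'.1 ^ 2 + g'.2.1 ^ 2) := by rw [hw]; ring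
      _ ≤ _ := mul_le_mul (norm_horizontal_le_kgauge_sq g) (norm_horizontal_le_kgauge_sq g')
          (by positivity) (by positivity)
  rw [kgauge_sq, hsum]
  calc _ ≤ ‖(⟨g.1 ^ 2 + g.2.1 ^ 2, g.2.2⟩ : ℂ)‖ + ‖(⟨g'.1 ^ 2 + g'.2.1 ^ 2, g'.2.2⟩ : ℂ)‖
        + ‖2 * w‖ := norm_add₃_le
    _ ≤ kgauge g ^ 2 + kgauge g' ^ 2 + 2 * (kgauge g * kgauge g') := by
        rw [← kgauge_sq, ← kgauge_sq, norm_mul]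
        simpa using hwn
    _ = _ := by ring

lemma kdist_nonneg (g g' : Hgrp) : 0 ≤ kdist g g' := kgauge_nonneg _

lemma kdist_self (g : Hgrp) : kdist g g = 0 := by
  simp [kdist, kgauge, hmul, hinv, mul_comm]

lemma kdist_comm (g g' : Hgrp) : kdist g g' = kdist g' g := by
  simp only [kdist, kgauge, hmul, hinv]
  congr 1; ring

lemma kdist_triangle (a b c : Hgrp) : kdist a c ≤ kdist a b + kdist b c := by
  have : hmul (hinv a) c = hmul (hmul (hinv a) b) (hmul (hinv b) c) := by
    simp only [hmul, hinv, Prod.mk.injEq]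
    refine ⟨by ring, by ring, by ring⟩
  unfold kdist
  rw [this]
  exact kgauge_hmul_le _ _

lemma continuous_kdist : Continuous fun p : Hgrp × Hgrp => kdist p.1 p.2 := by
  unfold kdist kgauge hmul hinv
  refine Continuous.rpow_const ?_ fun _ => Or.inr (by norm_num)
  fun_prop

lemma eq_of_kdist_eq_zero {a b : Hgrp} (h : kdist a b = 0) : a = b := by
  have h1 := abs_fst_le_kgauge (hmul (hinv a) b)
  have h2 := abs_snd_le_kgauge (hmul (hinv a) b)
  have h3 := abs_vertical_le_kgauge_sq (hmul (hinv a) b)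
  change kgauge _ = 0 at h
  rw [h] at h1 h2 h3
  simp only [hmul, hinv, abs_nonpos_iff, ne_eq, OfNat.ofNat_ne_zero, not_false_eq_true,
    zero_pow] at h1 h2 h3
  have e1 : a.1 = b.1 := by linarith
  have e2 : a.2.1 = b.2.1 := by linarith
  rw [← e1, ← e2] at h3
  exact Prod.ext e1 (Prod.ext e2 (by linarith))

/-- The Heisenberg group carrying the Korányi metric. -/
def KoranyiSpace : Type := Hgrp

/-- The underlying point of `ℝ³`. -/
def KoranyiSpace.toHgrp (a : KoranyiSpace) : Hgrp := a

instance : EMetricSpace KoranyiSpace where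
  edist a b := ENNReal.ofReal (kdist a.toHgrp b.toHgrp)
  edist_self a := by rw [kdist_self, ENNReal.ofReal_zero]
  edist_comm a b := by rw [kdist_comm]
  edist_triangle a b c := by
    rw [← ENNReal.ofReal_add (kdist_nonneg _ _) (kdist_nonneg _ _)]
    exact ENNReal.ofReal_le_ofReal (kdist_triangle _ _ _)
  eq_of_edist_eq_zero := by
    intro a b h
    exact eq_of_kdist_eq_zero (le_antisymm (ENNReal.ofReal_eq_zero.1 h) (kdist_nonneg _ _))

instance : MeasurableSpace KoranyiSpace := borel KoranyiSpace

instance : BorelSpace KoranyiSpace := ⟨rfl⟩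

lemma KoranyiSpace.continuous_toHgrp : Continuous KoranyiSpace.toHgrp := by
  rw [continuous_iff_continuousAt]
  intro a
  have hk : Tendsto (fun b : KoranyiSpace => kgauge (hmul (hinv a.toHgrp) b.toHgrp)) (𝓝 a)
      (𝓝 0) := by
    have h1 : Tendsto (fun b : KoranyiSpace => edist a b) (𝓝 a) (𝓝 0) := by
      have : Continuous fun b : KoranyiSpace => edist a b := by fun_prop
      simpa using this.tendsto a
    have h2 := (ENNReal.tendsto_toReal ENNReal.zero_ne_top).comp h1
    refine h2.congr fun b => ?_
    exact ENNReal.toReal_ofReal (kdist_nonneg _ _)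
  have hx : Tendsto (fun b : KoranyiSpace => (hmul (hinv a.toHgrp) b.toHgrp).1) (𝓝 a) (𝓝 0) :=
    squeeze_zero_norm (fun b => abs_fst_le_kgauge _) hk
  have hy : Tendsto (fun b : KoranyiSpace => (hmul (hinv a.toHgrp) b.toHgrp).2.1) (𝓝 a) (𝓝 0) :=
    squeeze_zero_norm (fun b => abs_snd_le_kgauge _) hk
  have ht : Tendsto (fun b : KoranyiSpace => (hmul (hinv a.toHgrp) b.toHgrp).2.2) (𝓝 a) (𝓝 0) :=
    squeeze_zero_norm (fun b => abs_vertical_le_kgauge_sq _) (by simpa using hk.pow 2)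
  have hx' : Tendsto (fun b : KoranyiSpace => b.toHgrp.1) (𝓝 a) (𝓝 a.toHgrp.1) := by
    simpa [hmul, hinv] using hx.add_const a.toHgrp.1
  have hy' : Tendsto (fun b : KoranyiSpace => b.toHgrp.2.1) (𝓝 a) (𝓝 a.toHgrp.2.1) := by
    simpa [hmul, hinv] using hy.add_const a.toHgrp.2.1
  refine hx'.prodMk_nhds (hy'.prodMk_nhds ?_)
  have hs := (ht.add_const a.toHgrp.2.2).add
    (((hx'.mul_const a.toHgrp.2.1).sub (hy'.const_mul a.toHgrp.1)).const_mul 2)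
  have e : 0 + a.toHgrp.2.2 + 2 * (a.toHgrp.1 * a.toHgrp.2.1 - a.toHgrp.1 * a.toHgrp.2.1)
    = a.toHgrp.2.2 := by ring
  rw [e] at hs
  refine hs.congr fun b => ?_
  change _ = b.toHgrp.2.2
  simp only [hmul, hinv]
  ring

lemma kHaus2_eq_hausdorffMeasure (S : Set Hgrp) :
    kHaus2 S = μH[2] (KoranyiSpace.toHgrp ⁻¹' S) := by
  rw [Measure.hausdorffMeasure_apply]
  have hd : ∀ c : Set KoranyiSpace,
      (⨆ _ : c.Nonempty, Metric.ediam c ^ (2 : ℝ)) = kdiam c ^ 2 := by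
    intro c
    have hk : Metric.ediam c = kdiam c := rfl
    rcases Set.eq_empty_or_nonempty c with rfl | hc
    · rw [← hk]; simp
    · rw [iSup_pos hc, ENNReal.rpow_two, hk]
  simp only [hd]
  rfl

/-- The Borel measure on `ℝ³` given by the two-dimensional Korányi Hausdorff measure. -/
def kMeasure : Measure Hgrp := (μH[2] : Measure KoranyiSpace).map KoranyiSpace.toHgrp

lemma kMeasure_apply {S : Set Hgrp} (hS : MeasurableSet S) : kMeasure S = kHaus2 S := by
  rw [kMeasure, Measure.map_apply KoranyiSpace.continuous_toHgrp.measurable hS,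
    kHaus2_eq_hausdorffMeasure]

lemma kHaus2_mono {S T : Set Hgrp} (h : S ⊆ T) : kHaus2 S ≤ kHaus2 T := by
  simp only [kHaus2_eq_hausdorffMeasure]
  exact measure_mono (preimage_mono h)

lemma kHaus2_iUnion_le (S : ℕ → Set Hgrp) : kHaus2 (⋃ n, S n) ≤ ∑' n, kHaus2 (S n) := by
  simp only [kHaus2_eq_hausdorffMeasure, preimage_iUnion]
  exact measure_iUnion_le _

/-! ### Nested dyadic tiles of the Heisenberg group -/

/-- The largest multiple of `2⁻ⁿ` below `z`. -/
def dyadicFloor (n : ℕ) (z : ℝ) : ℝ := ⌊2 ^ n * z⌋ / 2 ^ n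

lemma dyadicFloor_le (n : ℕ) (z : ℝ) : dyadicFloor n z ≤ z := by
  rw [dyadicFloor, div_le_iff₀ (by positivity), mul_comm z]
  exact Int.floor_le _

lemma le_dyadicFloor_add (n : ℕ) (z : ℝ) : z ≤ dyadicFloor n z + (1 / 2) ^ n := by
  have h := (Int.lt_floor_add_one (2 ^ n * z)).le
  have h2 : (0 : ℝ) < 2 ^ n := by positivity
  rw [dyadicFloor, one_div, inv_pow, ← one_div, ← add_div, le_div_iff₀ h2]
  linarith

lemma floor_two_pow_mul (n : ℕ) (z : ℝ) : ⌊2 ^ n * z⌋ = ⌊2 ^ (n + 1) * z⌋ / 2 := by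
  have h : (2 : ℝ) ^ n * z = 2 ^ (n + 1) * z / (2 : ℕ) := by
    push_cast; ring
  rw [h, Int.floor_div_natCast]
  rfl

lemma dyadicFloor_le_succ (n : ℕ) (z : ℝ) : dyadicFloor n z ≤ dyadicFloor (n + 1) z := by
  rw [dyadicFloor, dyadicFloor, pow_succ, div_le_div_iff₀ (by positivity) (by positivity),
    floor_two_pow_mul]
  have h : (2 * (⌊(2 : ℝ) ^ (n + 1) * z⌋ / 2 : ℤ) : ℝ) ≤ (⌊(2 : ℝ) ^ (n + 1) * z⌋ : ℤ) := by
    exact_mod_cast (by lia)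
  have h2 : (0 : ℝ) < 2 ^ n := by positivity
  rw [pow_succ] at *
  nlinarith

lemma monotone_dyadicFloor (z : ℝ) : Monotone fun n => dyadicFloor n z :=
  monotone_nat_of_le_succ fun n => dyadicFloor_le_succ n z

lemma tendsto_dyadicFloor (z : ℝ) : Tendsto (fun n => dyadicFloor n z) atTop (𝓝 z) := by
  have h : Tendsto (fun n : ℕ => z - (1 / 2 : ℝ) ^ n) atTop (𝓝 z) := by
    simpa using (tendsto_pow_atTop_nhds_zero_of_lt_one (by norm_num : (0 : ℝ) ≤ 1 / 2)
      (by norm_num)).const_sub z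
  refine tendsto_of_tendsto_of_tendsto_of_le_of_le h tendsto_const_nhds (fun n => ?_)
    (fun n => dyadicFloor_le n z)
  have := le_dyadicFloor_add n z
  dsimp only
  linarith

lemma floor_eq_of_le {z z' : ℝ} {m n : ℕ} (hmn : m ≤ n) (h : ⌊2 ^ n * z⌋ = ⌊2 ^ n * z'⌋) :
    ⌊2 ^ m * z⌋ = ⌊2 ^ m * z'⌋ := by
  induction n, hmn using Nat.le_induction with
  | base => exact h
  | succ n _ ih => exact ih (by rw [floor_two_pow_mul, floor_two_pow_mul n z', h])

/-- The increments of the dyadic Riemann sum of `y dx` along the dyadic approximations of a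
point. -/
def areaTerm (x y : ℝ) (j : ℕ) : ℝ := dyadicFloor j y * (dyadicFloor (j + 1) x - dyadicFloor j x)

/-- The dyadic Riemann sum of `y dx` along the dyadic approximations of a point. -/
def areaSum (x y : ℝ) : ℝ := ∑' j, areaTerm x y j

lemma summable_areaTerm (x y : ℝ) : Summable (areaTerm x y) := by
  have hg : Summable fun j : ℕ => (|y| + 1) * (1 / 2 : ℝ) ^ j :=
    (summable_geometric_of_lt_one (by norm_num) (by norm_num)).mul_left _
  refine Summable.of_norm_bounded hg fun j => ?_
  rw [areaTerm, norm_mul, Real.norm_eq_abs, Real.norm_eq_abs]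
  have h1 := dyadicFloor_le j y
  have h2 := le_dyadicFloor_add j y
  have h3 := dyadicFloor_le (j + 1) x
  have h4 := le_dyadicFloor_add j x
  have h5 := dyadicFloor_le_succ j x
  have h6 : (1 / 2 : ℝ) ^ j ≤ 1 := pow_le_one₀ (by norm_num) (by norm_num)
  refine mul_le_mul ?_ ?_ (abs_nonneg _) (by positivity)
  · rw [abs_le]
    constructor
    · linarith [neg_abs_le y]
    · linarith [le_abs_self y]
  · rw [abs_le]
    constructor <;> linarith

lemma areaSum_sub_mem (x y : ℝ) (k : ℕ) :
    areaSum x y - ∑ j ∈ Finset.range k, areaTerm x y j - dyadicFloor k y * (x - dyadicFloor k x)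
      ∈ Icc (0 : ℝ) ((1 / 4) ^ k) := by
  have hb : ∀ n, k ≤ n →
      dyadicFloor k y * (dyadicFloor n x - dyadicFloor k x) ≤
        ∑ j ∈ Finset.range n, areaTerm x y j - ∑ j ∈ Finset.range k, areaTerm x y j ∧
      ∑ j ∈ Finset.range n, areaTerm x y j - ∑ j ∈ Finset.range k, areaTerm x y j ≤
        (dyadicFloor k y + (1 / 2) ^ k) * (dyadicFloor n x - dyadicFloor k x) := by
    intro n hn
    induction n, hn using Nat.le_induction with
    | base => simp
    | succ n hkn ih =>
      rw [Finset.sum_range_succ, areaTerm]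
      have h1 : dyadicFloor k y ≤ dyadicFloor n y := monotone_dyadicFloor y hkn
      have h2 : dyadicFloor n y ≤ dyadicFloor k y + (1 / 2) ^ k :=
        (dyadicFloor_le n y).trans (le_dyadicFloor_add k y)
      have h3 : 0 ≤ dyadicFloor (n + 1) x - dyadicFloor n x :=
        sub_nonneg.2 (dyadicFloor_le_succ n x)
      constructor
      · nlinarith [mul_le_mul_of_nonneg_right h1 h3]
      · nlinarith [mul_le_mul_of_nonneg_right h2 h3]
  have hs := ((summable_areaTerm x y).hasSum.tendsto_sum_nat).sub_const
    (∑ j ∈ Finset.range k, areaTerm x y j)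
  have hx := (tendsto_dyadicFloor x).sub_const (dyadicFloor k x)
  have hl := le_of_tendsto_of_tendsto (hx.const_mul (dyadicFloor k y)) hs
    (eventually_atTop.2 ⟨k, fun n hn => (hb n hn).1⟩)
  have hu := le_of_tendsto_of_tendsto hs (hx.const_mul (dyadicFloor k y + (1 / 2) ^ k))
    (eventually_atTop.2 ⟨k, fun n hn => (hb n hn).2⟩)
  have h4 : (1 / 4 : ℝ) ^ k = (1 / 2) ^ k * (1 / 2) ^ k := by
    rw [← mul_pow]; norm_num
  have h5 := le_dyadicFloor_add k x
  have h6 : (0 : ℝ) ≤ (1 / 2) ^ k := by positivity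
  rw [areaSum, h4]
  constructor
  · linarith
  · nlinarith [mul_le_mul_of_nonneg_left h5 h6]

lemma abs_areaSum_sub_le {x y x' y' : ℝ} {k : ℕ} (hx : ⌊2 ^ k * x⌋ = ⌊2 ^ k * x'⌋)
    (hy : ⌊2 ^ k * y⌋ = ⌊2 ^ k * y'⌋) :
    |areaSum x' y' - areaSum x y - dyadicFloor k y * (x' - x)| ≤ (1 / 4) ^ k := by
  have h := areaSum_sub_mem x y k
  have h' := areaSum_sub_mem x' y' k
  have hxj : ∀ j ≤ k, dyadicFloor j x = dyadicFloor j x' := fun j hj => by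
    rw [dyadicFloor, dyadicFloor, floor_eq_of_le hj hx]
  have hyj : ∀ j ≤ k, dyadicFloor j y = dyadicFloor j y' := fun j hj => by
    rw [dyadicFloor, dyadicFloor, floor_eq_of_le hj hy]
  have hsum : ∑ j ∈ Finset.range k, areaTerm x' y' j = ∑ j ∈ Finset.range k, areaTerm x y j := by
    refine Finset.sum_congr rfl fun j hj => ?_
    have hj := Finset.mem_range.1 hj
    rw [areaTerm, areaTerm, hxj j hj.le, hyj j hj.le, hxj (j + 1) hj]
  rw [hsum, ← hxj k le_rfl, ← hyj k le_rfl] at h'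
  rw [abs_le]
  constructor <;> linarith [h.1, h.2, h'.1, h'.2]

/-- The vertical coordinate straightened along the dyadic approximations of the base point. -/
def sheared (g : Hgrp) : ℝ := g.2.2 + 2 * g.1 * g.2.1 - 4 * areaSum g.1 g.2.1

/-- The label of the tile of generation `k` containing a point. -/
def tileLabel (k : ℕ) (g : Hgrp) : ℤ × ℤ × ℤ :=
  (⌊2 ^ k * g.1⌋, ⌊2 ^ k * g.2.1⌋, ⌊2 ^ (2 * k) * sheared g⌋)

lemma tileLabel_eq_of_le {g g' : Hgrp} {m n : ℕ} (hmn : m ≤ n)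
    (h : tileLabel n g = tileLabel n g') : tileLabel m g = tileLabel m g' := by
  simp only [tileLabel, Prod.mk.injEq] at h ⊢
  exact ⟨floor_eq_of_le hmn h.1, floor_eq_of_le hmn h.2.1,
    floor_eq_of_le (Nat.mul_le_mul_left 2 hmn) h.2.2⟩

lemma abs_sub_le_of_floor_eq {z z' : ℝ} {k : ℕ} (h : ⌊2 ^ k * z⌋ = ⌊2 ^ k * z'⌋) :
    |z' - z| ≤ (1 / 2) ^ k := by
  have h1 := dyadicFloor_le k z
  have h2 := le_dyadicFloor_add k z
  have h3 := dyadicFloor_le k z'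
  have h4 := le_dyadicFloor_add k z'
  have h5 : dyadicFloor k z = dyadicFloor k z' := by rw [dyadicFloor, dyadicFloor, h]
  rw [abs_le]
  constructor <;> linarith

lemma abs_vertical_sub_sheared_le {g g' : Hgrp} {k : ℕ} (hx : ⌊2 ^ k * g.1⌋ = ⌊2 ^ k * g'.1⌋)
    (hy : ⌊2 ^ k * g.2.1⌋ = ⌊2 ^ k * g'.2.1⌋) :
    |(hmul (hinv g) g').2.2 - (sheared g' - sheared g)| ≤ 10 * (1 / 4) ^ k := by
  have h1 := abs_areaSum_sub_le hx hy
  have h2 := abs_sub_le_of_floor_eq hx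
  have h3 := abs_sub_le_of_floor_eq hy
  have h4 : |g.2.1 - dyadicFloor k g.2.1| ≤ (1 / 2) ^ k := by
    rw [abs_le]
    have := dyadicFloor_le k g.2.1
    have := le_dyadicFloor_add k g.2.1
    have h6 : (0 : ℝ) ≤ (1 / 2) ^ k := by positivity
    constructor <;> linarith
  have h5 : (1 / 4 : ℝ) ^ k = (1 / 2) ^ k * (1 / 2) ^ k := by
    rw [← mul_pow]; norm_num
  have h6 := mul_le_mul h4 h2 (abs_nonneg _) (by positivity)
  have h7 := mul_le_mul h2 h3 (abs_nonneg _) (by positivity)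
  rw [← abs_mul, ← h5] at h6 h7
  rw [abs_le] at *
  have e : (hmul (hinv g) g').2.2 - (sheared g' - sheared g)
      = 4 * (areaSum g'.1 g'.2.1 - areaSum g.1 g.2.1 - dyadicFloor k g.2.1 * (g'.1 - g.1))
        - 4 * ((g.2.1 - dyadicFloor k g.2.1) * (g'.1 - g.1))
        - 2 * ((g'.1 - g.1) * (g'.2.1 - g.2.1)) := by
    simp only [hmul, hinv, sheared]; ring
  rw [e]
  constructor <;> linarith [h1.1, h1.2, h6.1, h6.2, h7.1, h7.2]

lemma kdist_le_of_tileLabel_eq {g g' : Hgrp} {k : ℕ} (h : tileLabel k g = tileLabel k g') :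
    kdist g g' ≤ 4 * (1 / 2) ^ k := by
  simp only [tileLabel, Prod.mk.injEq] at h
  have h1 := abs_vertical_sub_sheared_le h.1 h.2.1
  have h2 := abs_sub_le_of_floor_eq h.1
  have h3 := abs_sub_le_of_floor_eq h.2.1
  have h4 := abs_sub_le_of_floor_eq h.2.2
  have h5 : (1 / 2 : ℝ) ^ (2 * k) = (1 / 4) ^ k := by rw [pow_mul]; norm_num
  have h6 : (1 / 4 : ℝ) ^ k = ((1 / 2) ^ k) ^ 2 := by rw [← pow_mul, mul_comm k 2, h5]
  rw [h5] at h4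
  have h7 : |(hmul (hinv g) g').2.2| ≤ 11 * (1 / 4) ^ k := by
    rw [abs_le] at *
    constructor <;> linarith [h1.1, h1.2, h4.1, h4.2]
  have hx : (hmul (hinv g) g').1 ^ 2 ≤ (1 / 4) ^ k := by
    rw [h6, sq_le_sq, abs_of_pos (by positivity : (0 : ℝ) < (1 / 2) ^ k)]
    simpa [hmul, hinv, neg_add_eq_sub] using h2
  have hy : (hmul (hinv g) g').2.1 ^ 2 ≤ (1 / 4) ^ k := by
    rw [h6, sq_le_sq, abs_of_pos (by positivity : (0 : ℝ) < (1 / 2) ^ k)]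
    simpa [hmul, hinv, neg_add_eq_sub] using h3
  have ht : (hmul (hinv g) g').2.2 ^ 2 ≤ (11 * (1 / 4) ^ k) ^ 2 := by
    rw [sq_le_sq, abs_of_pos (by positivity : (0 : ℝ) < 11 * (1 / 4) ^ k)]
    exact h7
  have hxy : ((hmul (hinv g) g').1 ^ 2 + (hmul (hinv g) g').2.1 ^ 2) ^ 2
      ≤ (2 * (1 / 4) ^ k) ^ 2 :=
    pow_le_pow_left₀ (by positivity) (by linarith) 2
  refine le_of_pow_le_pow_left₀ (n := 4) (by norm_num) (by positivity) ?_
  rw [kdist, kgauge_pow_four, mul_pow, show ((1 / 2 : ℝ) ^ k) ^ 4 = ((1 / 4) ^ k) ^ 2 by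
    rw [h6]; ring]
  nlinarith [sq_nonneg ((1 / 4 : ℝ) ^ k)]

lemma floor_mem_Icc_of_abs_sub_le {a b : ℝ} {n : ℕ} (h : |b - a| ≤ n) :
    ⌊b⌋ ∈ Finset.Icc (⌊a⌋ - n) (⌊a⌋ + n) := by
  rw [abs_le] at h
  rw [Finset.mem_Icc, Int.le_floor]
  constructor
  · push_cast
    linarith [Int.floor_le a]
  · rw [← Int.floor_add_natCast]
    exact Int.floor_le_floor (by linarith)

lemma exists_tileLabel_finset {k : ℕ} {U : Set Hgrp}
    (hU : ∀ g ∈ U, ∀ g' ∈ U, kdist g g' ≤ (1 / 2) ^ k) :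
    ∃ s : Finset (ℤ × ℤ × ℤ), s.card ≤ 207 ∧ ∀ g ∈ U, tileLabel k g ∈ s := by
  classical
  rcases U.eq_empty_or_nonempty with rfl | ⟨g₀, hg₀⟩
  · exact ⟨∅, by simp, by simp⟩
  have hscale : ∀ {a : ℝ}, |a| ≤ (1 / 2) ^ k → |2 ^ k * a| ≤ (1 : ℕ) := by
    intro a ha
    rw [abs_mul, abs_of_pos (by positivity : (0 : ℝ) < 2 ^ k)]
    calc (2 : ℝ) ^ k * |a| ≤ 2 ^ k * (1 / 2) ^ k := by gcongr
      _ = _ := by rw [← mul_pow]; norm_num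
  have hfib : ∀ m n : ℤ, ∃ j : ℤ, ∀ g ∈ U, ⌊2 ^ k * g.1⌋ = m → ⌊2 ^ k * g.2.1⌋ = n →
      ⌊2 ^ (2 * k) * sheared g⌋ ∈ Finset.Icc (j - 11) (j + 11) := by
    intro m n
    by_cases hex : ∃ g ∈ U, ⌊2 ^ k * g.1⌋ = m ∧ ⌊2 ^ k * g.2.1⌋ = n
    · obtain ⟨g₁, hg₁, hm, hn⟩ := hex
      refine ⟨⌊2 ^ (2 * k) * sheared g₁⌋, fun g hg hgm hgn => ?_⟩
      refine floor_mem_Icc_of_abs_sub_le (n := 11) ?_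
      have h1 := abs_vertical_sub_sheared_le (hm.trans hgm.symm) (hn.trans hgn.symm)
      have h2 := (abs_vertical_le_kgauge_sq (hmul (hinv g₁) g)).trans
        (pow_le_pow_left₀ (kgauge_nonneg _) (hU g₁ hg₁ g hg) 2)
      have h6 : ((1 / 2 : ℝ) ^ k) ^ 2 = (1 / 4) ^ k := by
        rw [← pow_mul, mul_comm k 2, pow_mul]; norm_num
      rw [h6] at h2
      have h3 : |sheared g - sheared g₁| ≤ 11 * (1 / 4) ^ k := by
        rw [abs_le] at *
        constructor <;> linarith [h1.1, h1.2, h2.1, h2.2]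
      rw [← mul_sub, abs_mul, abs_of_pos (by positivity : (0 : ℝ) < 2 ^ (2 * k)), pow_mul]
      calc ((2 : ℝ) ^ 2) ^ k * |sheared g - sheared g₁|
          ≤ (2 ^ 2) ^ k * (11 * (1 / 4) ^ k) := by gcongr
        _ = 11 * ((2 ^ 2) ^ k * (1 / 4) ^ k) := by ring
        _ = _ := by rw [← mul_pow]; norm_num
    · exact ⟨0, fun g hg h1 h2 => absurd ⟨g, hg, h1, h2⟩ hex⟩
  choose j hj using hfib
  let sq : Finset (ℤ × ℤ) := Finset.Icc (⌊2 ^ k * g₀.1⌋ - 1) (⌊2 ^ k * g₀.1⌋ + 1) ×ˢ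
    Finset.Icc (⌊2 ^ k * g₀.2.1⌋ - 1) (⌊2 ^ k * g₀.2.1⌋ + 1)
  refine ⟨sq.biUnion fun p => (Finset.Icc (j p.1 p.2 - 11) (j p.1 p.2 + 11)).image
    fun i => (p.1, p.2, i), ?_, fun g hg => ?_⟩
  · refine (Finset.card_biUnion_le_card_mul _ _ 23 fun p _ => ?_).trans ?_
    · refine Finset.card_image_le.trans ?_
      rw [Int.card_Icc]
      lia
    · have h3 : ∀ a : ℤ, (Finset.Icc (a - 1) (a + 1)).card = 3 := fun a => by
        rw [Int.card_Icc]; lia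
      rw [Finset.card_product, h3, h3]
  · rw [Finset.mem_biUnion]
    refine ⟨(⌊2 ^ k * g.1⌋, ⌊2 ^ k * g.2.1⌋), Finset.mem_product.2 ⟨?_, ?_⟩,
      Finset.mem_image.2 ⟨_, hj _ _ g hg rfl rfl, rfl⟩⟩
    · refine floor_mem_Icc_of_abs_sub_le (n := 1) ?_
      rw [← mul_sub]
      refine hscale (le_trans ?_ (hU g₀ hg₀ g hg))
      simpa [kdist, hmul, hinv, neg_add_eq_sub] using abs_fst_le_kgauge (hmul (hinv g₀) g)
    · refine floor_mem_Icc_of_abs_sub_le (n := 1) ?_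
      rw [← mul_sub]
      refine hscale (le_trans ?_ (hU g₀ hg₀ g hg))
      simpa [kdist, hmul, hinv, neg_add_eq_sub] using abs_snd_le_kgauge (hmul (hinv g₀) g)

/-! ### Net contents -/

/-- Labels of nested partitions: agreement in generation `n` forces agreement in all earlier
generations. -/
def NestedLabels {X ι : Type*} (ℓ : ℕ → X → ι) : Prop :=
  ∀ m n x y, m ≤ n → ℓ n x = ℓ n y → ℓ m x = ℓ m y

section Tiles

variable {X ι : Type*} {ℓ : ℕ → X → ι}

/-- The tile `c'` is contained in the tile `c`, and meets it. -/
def TileLE (ℓ : ℕ → X → ι) (c c' : ℕ × ι) : Prop :=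
  c.1 ≤ c'.1 ∧ ∃ x, ℓ c.1 x = c.2 ∧ ℓ c'.1 x = c'.2

lemma TileLE.label_eq (hnest : NestedLabels ℓ)
    {c c' : ℕ × ι} (h : TileLE ℓ c c') {x : X} (hx : ℓ c'.1 x = c'.2) : ℓ c.1 x = c.2 := by
  obtain ⟨hle, y, hy, hy'⟩ := h
  rw [← hy]
  exact hnest _ _ _ _ hle (hx.trans hy'.symm)

/-- The members of `𝒜` not absorbed by a tile of `ℬ`. -/
def keptOld (ℓ : ℕ → X → ι) (𝒜 ℬ : Set (ℕ × ι)) : Set (ℕ × ι) :=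
  {c ∈ 𝒜 | ¬∃ c' ∈ ℬ, TileLE ℓ c' c}

/-- The members of `ℬ` not absorbed by a surviving tile of `𝒜`. -/
def keptNew (ℓ : ℕ → X → ι) (𝒜 ℬ : Set (ℕ × ι)) : Set (ℕ × ι) :=
  {c ∈ ℬ | ¬∃ c' ∈ keptOld ℓ 𝒜 ℬ, TileLE ℓ c' c}

/-- Successively merged covers, in which larger tiles absorb smaller ones. -/
def mergedCover (ℓ : ℕ → X → ι) (𝒞 : ℕ → Set (ℕ × ι)) : ℕ → Set (ℕ × ι)
  | 0 => 𝒞 0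
  | m + 1 => keptOld ℓ (mergedCover ℓ 𝒞 m) (𝒞 (m + 1)) ∪
      keptNew ℓ (mergedCover ℓ 𝒞 m) (𝒞 (m + 1))

lemma exists_le_mem_kept_of_mem_new
    (hnest : NestedLabels ℓ) {𝒜 ℬ : Set (ℕ × ι)} {x : X}
    {k : ℕ} (hk : (k, ℓ k x) ∈ ℬ) :
    ∃ j ≤ k, (j, ℓ j x) ∈ keptOld ℓ 𝒜 ℬ ∪ keptNew ℓ 𝒜 ℬ := by
  by_cases h : ∃ c' ∈ keptOld ℓ 𝒜 ℬ, TileLE ℓ c' (k, ℓ k x)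
  · obtain ⟨⟨j, i⟩, hc, hle⟩ := h
    have := hle.label_eq hnest (x := x) rfl
    dsimp only at this
    subst this
    exact ⟨j, hle.1, Or.inl hc⟩
  · exact ⟨k, le_rfl, Or.inr ⟨hk, h⟩⟩

lemma exists_le_mem_kept_of_mem_old
    (hnest : NestedLabels ℓ) {𝒜 ℬ : Set (ℕ × ι)} {x : X}
    {k : ℕ} (hk : (k, ℓ k x) ∈ 𝒜) :
    ∃ j ≤ k, (j, ℓ j x) ∈ keptOld ℓ 𝒜 ℬ ∪ keptNew ℓ 𝒜 ℬ := by
  by_cases h : ∃ c' ∈ ℬ, TileLE ℓ c' (k, ℓ k x)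
  · obtain ⟨⟨j, i⟩, hc, hle⟩ := h
    have := hle.label_eq hnest (x := x) rfl
    dsimp only at this
    subst this
    obtain ⟨l, hl, hmem⟩ := exists_le_mem_kept_of_mem_new hnest (𝒜 := 𝒜) hc
    exact ⟨l, hl.trans hle.1, hmem⟩
  · exact ⟨k, le_rfl, Or.inl ⟨hk, h⟩⟩

lemma mergedCover_covers (hnest : NestedLabels ℓ)
    {𝒞 : ℕ → Set (ℕ × ι)} {S : ℕ → Set X} (h𝒞 : ∀ n, ∀ x ∈ S n, ∃ k, (k, ℓ k x) ∈ 𝒞 n) (n : ℕ) :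
    ∀ x ∈ S n, ∃ k, (k, ℓ k x) ∈ mergedCover ℓ 𝒞 n := by
  cases n with
  | zero => exact h𝒞 0
  | succ m =>
    intro x hx
    obtain ⟨k, hk⟩ := h𝒞 (m + 1) x hx
    obtain ⟨j, -, hj⟩ := exists_le_mem_kept_of_mem_new hnest (𝒜 := mergedCover ℓ 𝒞 m) hk
    exact ⟨j, hj⟩

end Tiles

/-- The content of `S` computed by covering it with tiles, where `ℓ k x` is the label of the tile
of generation `k` containing `x` and `μ` weighs families of tiles. -/
def netContent {X ι : Type*} [MeasurableSpace (ℕ × ι)] (ℓ : ℕ → X → ι) (μ : Measure (ℕ × ι))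
    (S : Set X) : ℝ≥0∞ :=
  ⨅ (𝒞 : Set (ℕ × ι)) (_ : ∀ x ∈ S, ∃ k, (k, ℓ k x) ∈ 𝒞), μ 𝒞

section NetContent

variable {X ι : Type*} [MeasurableSpace (ℕ × ι)] {ℓ : ℕ → X → ι} {μ : Measure (ℕ × ι)}

lemma netContent_le {S : Set X} {𝒞 : Set (ℕ × ι)} (h : ∀ x ∈ S, ∃ k, (k, ℓ k x) ∈ 𝒞) :
    netContent ℓ μ S ≤ μ 𝒞 := iInf₂_le _ h

lemma netContent_mono {S T : Set X} (h : S ⊆ T) : netContent ℓ μ S ≤ netContent ℓ μ T :=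
  le_iInf₂ fun _ h𝒞 => netContent_le fun x hx => h𝒞 x (h hx)

lemma exists_cover_lt_of_netContent_lt {S : Set X} {c : ℝ≥0∞} (h : netContent ℓ μ S < c) :
    ∃ 𝒞 : Set (ℕ × ι), (∀ x ∈ S, ∃ k, (k, ℓ k x) ∈ 𝒞) ∧ μ 𝒞 < c := by
  simpa only [netContent, iInf_lt_iff, exists_prop] using h

lemma netContent_iUnion_le (S : ℕ → Set X) :
    netContent ℓ μ (⋃ n, S n) ≤ ∑' n, netContent ℓ μ (S n) := by
  refine ENNReal.le_of_forall_pos_le_add fun ε hε hfin => ?_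
  obtain ⟨δ, hδ, hsum⟩ := ENNReal.exists_pos_sum_of_countable (ENNReal.coe_pos.2 hε).ne' ℕ
  have hlt : ∀ n, netContent ℓ μ (S n) < netContent ℓ μ (S n) + δ n := fun n =>
    ENNReal.lt_add_right ((ENNReal.le_tsum n).trans_lt hfin).ne (ENNReal.coe_pos.2 (hδ n)).ne'
  choose 𝒞 h𝒞 hμ using fun n => exists_cover_lt_of_netContent_lt (hlt n)
  calc netContent ℓ μ (⋃ n, S n) ≤ μ (⋃ n, 𝒞 n) := netContent_le fun x hx => by
        obtain ⟨n, hn⟩ := mem_iUnion.1 hx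
        obtain ⟨k, hk⟩ := h𝒞 n x hn
        exact ⟨k, mem_iUnion.2 ⟨n, hk⟩⟩
    _ ≤ ∑' n, μ (𝒞 n) := measure_iUnion_le _
    _ ≤ ∑' n, (netContent ℓ μ (S n) + δ n) := ENNReal.tsum_le_tsum fun n => (hμ n).le
    _ = ∑' n, netContent ℓ μ (S n) + ∑' n, (δ n : ℝ≥0∞) := ENNReal.tsum_add
    _ ≤ _ := by gcongr

lemma netContent_add_measure_kept_le [DiscreteMeasurableSpace (ℕ × ι)] {𝒜 ℬ : Set (ℕ × ι)}
    {S : Set X} (h𝒜 : ∀ x ∈ S, ∃ k, (k, ℓ k x) ∈ 𝒜) (hℬ : ∀ x ∈ S, ∃ k, (k, ℓ k x) ∈ ℬ) :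
    netContent ℓ μ S + μ (keptOld ℓ 𝒜 ℬ ∪ keptNew ℓ 𝒜 ℬ) ≤ μ 𝒜 + μ ℬ := by
  have hcov : netContent ℓ μ S ≤ μ (𝒜 \ keptOld ℓ 𝒜 ℬ ∪ ℬ \ keptNew ℓ 𝒜 ℬ) := by
    refine netContent_le fun x hx => ?_
    obtain ⟨k, hk⟩ := h𝒜 x hx
    obtain ⟨j, hj⟩ := hℬ x hx
    by_cases hP : (k, ℓ k x) ∈ keptOld ℓ 𝒜 ℬ
    · rcases le_or_gt j k with hjk | hkj
      · exact absurd ⟨_, hj, hjk, x, rfl, rfl⟩ hP.2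
      · exact ⟨j, Or.inr ⟨hj, fun h => h.2 ⟨_, hP, hkj.le, x, rfl, rfl⟩⟩⟩
    · exact ⟨k, Or.inl ⟨hk, hP⟩⟩
  have h1 : μ (keptOld ℓ 𝒜 ℬ) + μ (𝒜 \ keptOld ℓ 𝒜 ℬ) = μ 𝒜 := by
    rw [measure_add_sdiff (MeasurableSet.of_discrete).nullMeasurableSet,
      union_eq_self_of_subset_left fun _ h => h.1]
  have h2 : μ (keptNew ℓ 𝒜 ℬ) + μ (ℬ \ keptNew ℓ 𝒜 ℬ) = μ ℬ := by
    rw [measure_add_sdiff (MeasurableSet.of_discrete).nullMeasurableSet,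
      union_eq_self_of_subset_left fun _ h => h.1]
  calc _ ≤ (μ (𝒜 \ keptOld ℓ 𝒜 ℬ) + μ (ℬ \ keptNew ℓ 𝒜 ℬ)) +
        (μ (keptOld ℓ 𝒜 ℬ) + μ (keptNew ℓ 𝒜 ℬ)) :=
        add_le_add (hcov.trans (measure_union_le _ _)) (measure_union_le _ _)
    _ = (μ (keptOld ℓ 𝒜 ℬ) + μ (𝒜 \ keptOld ℓ 𝒜 ℬ)) +
        (μ (keptNew ℓ 𝒜 ℬ) + μ (ℬ \ keptNew ℓ 𝒜 ℬ)) := by ring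
    _ = _ := by rw [h1, h2]

lemma measure_mergedCover_le [DiscreteMeasurableSpace (ℕ × ι)]
    (hnest : NestedLabels ℓ)
    {𝒞 : ℕ → Set (ℕ × ι)} {S : ℕ → Set X} (hS : Monotone S)
    (h𝒞 : ∀ n, ∀ x ∈ S n, ∃ k, (k, ℓ k x) ∈ 𝒞 n) (hfin : ∀ n, netContent ℓ μ (S n) ≠ ∞)
    {δ : ℕ → ℝ≥0∞} (hδ : ∀ n, μ (𝒞 n) ≤ netContent ℓ μ (S n) + δ n) (n : ℕ) :
    μ (mergedCover ℓ 𝒞 n) ≤ netContent ℓ μ (S n) + ∑ i ∈ Finset.range (n + 1), δ i := by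
  induction n with
  | zero => simpa [mergedCover] using hδ 0
  | succ m ih =>
    have h := netContent_add_measure_kept_le (μ := μ) (mergedCover_covers hnest h𝒞 m)
      fun x hx => h𝒞 (m + 1) x (hS m.le_succ hx)
    refine (ENNReal.add_le_add_iff_left (hfin m)).1 (h.trans ((add_le_add ih (hδ (m + 1))).trans ?_))
    rw [Finset.sum_range_succ _ (m + 1)]
    apply le_of_eq
    ring

/-- Net contents are continuous along increasing sequences of arbitrary sets. -/
theorem netContent_iUnion_of_monotone [DiscreteMeasurableSpace (ℕ × ι)]
    (hnest : NestedLabels ℓ)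
    {S : ℕ → Set X} (hS : Monotone S) :
    netContent ℓ μ (⋃ n, S n) = ⨆ n, netContent ℓ μ (S n) := by
  refine le_antisymm ?_ (iSup_le fun n => netContent_mono (subset_iUnion S n))
  refine ENNReal.le_of_forall_pos_le_add fun ε hε hsup => ?_
  have hfin : ∀ n, netContent ℓ μ (S n) ≠ ∞ := fun n =>
    ((le_iSup (fun n => netContent ℓ μ (S n)) n).trans_lt hsup).ne
  obtain ⟨δ, hδ, hsum⟩ := ENNReal.exists_pos_sum_of_countable (ENNReal.coe_pos.2 hε).ne' ℕ
  have hlt : ∀ n, netContent ℓ μ (S n) < netContent ℓ μ (S n) + δ n := fun n =>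
    ENNReal.lt_add_right (hfin n) (ENNReal.coe_pos.2 (hδ n)).ne'
  choose 𝒞 h𝒞 hμ using fun n => exists_cover_lt_of_netContent_lt (hlt n)
  have hcov : ∀ x ∈ ⋃ n, S n, ∃ k, (k, ℓ k x) ∈ ⋃ n, ⋂ m ≥ n, mergedCover ℓ 𝒞 m := by
    classical
    intro x hx
    obtain ⟨n, hn⟩ := mem_iUnion.1 hx
    have hex : ∃ k, ∃ m, (k, ℓ k x) ∈ mergedCover ℓ 𝒞 m := by
      obtain ⟨k, hk⟩ := mergedCover_covers hnest h𝒞 n x hn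
      exact ⟨k, n, hk⟩
    obtain ⟨m, hm⟩ := Nat.find_spec hex
    refine ⟨Nat.find hex, mem_iUnion.2 ⟨m, mem_iInter₂.2 fun m' hm' => ?_⟩⟩
    induction m', hm' using Nat.le_induction with
    | base => exact hm
    | succ m' _ ih =>
      obtain ⟨j, hj, hmem⟩ := exists_le_mem_kept_of_mem_old hnest (ℬ := 𝒞 (m' + 1)) ih
      have hmem' : (j, ℓ j x) ∈ mergedCover ℓ 𝒞 (m' + 1) := hmem
      rwa [le_antisymm hj (Nat.find_min' hex ⟨m' + 1, hmem'⟩)] at hmem'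
  refine (netContent_le hcov).trans ?_
  have hmono : Monotone fun n => ⋂ m ≥ n, mergedCover ℓ 𝒞 m := fun a b hab =>
    subset_iInter₂ fun m hm => iInter₂_subset m (le_trans hab hm)
  rw [hmono.measure_iUnion]
  refine iSup_le fun n => ?_
  calc μ (⋂ m ≥ n, mergedCover ℓ 𝒞 m) ≤ μ (mergedCover ℓ 𝒞 n) :=
        measure_mono (iInter₂_subset n le_rfl)
    _ ≤ netContent ℓ μ (S n) + ∑ i ∈ Finset.range (n + 1), (δ i : ℝ≥0∞) :=
        measure_mergedCover_le hnest hS h𝒞 hfin (fun n => (hμ n).le) n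
    _ ≤ _ := add_le_add (le_iSup (fun n => netContent ℓ μ (S n)) n)
        ((ENNReal.sum_le_tsum _).trans hsum.le)

end NetContent

/-! ### Comparison of the dyadic content with the Hausdorff measure -/

lemma kdiam_le_iff {S : Set Hgrp} {d : ℝ≥0∞} :
    kdiam S ≤ d ↔ ∀ a ∈ S, ∀ b ∈ S, ENNReal.ofReal (kdist a b) ≤ d := by
  simp only [kdiam, iSup_le_iff]

lemma ofReal_kdist_le_kdiam {S : Set Hgrp} {a b : Hgrp} (ha : a ∈ S) (hb : b ∈ S) :
    ENNReal.ofReal (kdist a b) ≤ kdiam S :=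
  kdiam_le_iff.1 le_rfl a ha b hb

/-- The weight of families of tiles: a tile of generation `k` weighs `4 ^ (-k)`. -/
def tileWeight : Measure (ℕ × ℤ × ℤ × ℤ) :=
  Measure.sum fun c => ENNReal.ofReal ((1 / 4) ^ c.1) • Measure.dirac c

lemma tileWeight_apply (𝒞 : Set (ℕ × ℤ × ℤ × ℤ)) :
    tileWeight 𝒞 = ∑' c, 𝒞.indicator (fun c => ENNReal.ofReal ((1 / 4) ^ c.1)) c := by
  rw [tileWeight, Measure.sum_apply _ MeasurableSet.of_discrete]
  refine tsum_congr fun c => ?_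
  by_cases h : c ∈ 𝒞 <;> simp [h]

/-- The dyadic content, comparable to the two-dimensional Hausdorff content. -/
def tileContent (S : Set Hgrp) : ℝ≥0∞ := netContent tileLabel tileWeight S

lemma tileContent_mono {S T : Set Hgrp} (h : S ⊆ T) : tileContent S ≤ tileContent T :=
  netContent_mono h

lemma nestedLabels_tileLabel : NestedLabels tileLabel := fun _ _ _ _ h => tileLabel_eq_of_le h

lemma tileContent_iUnion_of_monotone {S : ℕ → Set Hgrp} (hS : Monotone S) :
    tileContent (⋃ n, S n) = ⨆ n, tileContent (S n) :=
  netContent_iUnion_of_monotone nestedLabels_tileLabel hS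

lemma kdiam_tile_sq_le (k : ℕ) (i : ℤ × ℤ × ℤ) :
    kdiam {g | tileLabel k g = i} ^ 2 ≤ 16 * ENNReal.ofReal ((1 / 4) ^ k) := by
  have h : kdiam {g | tileLabel k g = i} ≤ ENNReal.ofReal (4 * (1 / 2) ^ k) :=
    kdiam_le_iff.2 fun a ha b hb =>
      ENNReal.ofReal_le_ofReal (kdist_le_of_tileLabel_eq (ha.trans hb.symm))
  calc _ ≤ ENNReal.ofReal (4 * (1 / 2) ^ k) ^ 2 := by gcongr
    _ = ENNReal.ofReal (16 * (1 / 4) ^ k) := by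
      rw [← ENNReal.ofReal_pow (by positivity), mul_pow, ← pow_mul, mul_comm k, pow_mul]
      norm_num
    _ = _ := by rw [ENNReal.ofReal_mul (by norm_num)]; norm_num

lemma kHaus2_eq_zero_of_tileContent_eq_zero {S : Set Hgrp} (h : tileContent S = 0) :
    kHaus2 S = 0 := by
  refine le_antisymm (iSup₂_le fun ε hε => le_of_forall_pos_le_add fun δ hδ => ?_) zero_le
  obtain ⟨η, hη, hηε, hηδ⟩ : ∃ η : ℝ≥0∞, 0 < η ∧ 16 * η ≤ ε ^ 2 ∧ 16 * η ≤ δ := by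
    have hm : 0 < min (ε ^ 2) δ := lt_min (ENNReal.pow_pos hε 2) hδ
    refine ⟨min (ε ^ 2) δ / 16, ENNReal.div_pos hm.ne' (by norm_num), ?_, ?_⟩
    · rw [ENNReal.mul_div_cancel (by norm_num) (by norm_num)]; exact min_le_left _ _
    · rw [ENNReal.mul_div_cancel (by norm_num) (by norm_num)]; exact min_le_right _ _
  obtain ⟨𝒞, h𝒞, hμ⟩ := exists_cover_lt_of_netContent_lt (h.trans_lt hη : netContent _ _ S < η)
  let e : (ℕ × ℤ × ℤ × ℤ) ≃ ℕ := Denumerable.eqv _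
  let c : ℕ → Set Hgrp := fun n => {g | e.symm n ∈ 𝒞 ∧ tileLabel (e.symm n).1 g = (e.symm n).2}
  have hc : ∀ n, kdiam (c n) ^ 2 ≤
      16 * 𝒞.indicator (fun c => ENNReal.ofReal ((1 / 4) ^ c.1)) (e.symm n) := by
    intro n
    by_cases hn : e.symm n ∈ 𝒞
    · rw [indicator_of_mem hn]
      simpa [c, hn] using kdiam_tile_sq_le (e.symm n).1 (e.symm n).2
    · simp [c, hn, kdiam]
  have hsum : ∑' n, kdiam (c n) ^ 2 ≤ 16 * tileWeight 𝒞 := by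
    rw [tileWeight_apply, ← ENNReal.tsum_mul_left,
      ← e.symm.tsum_eq fun i => 16 * 𝒞.indicator (fun c => ENNReal.ofReal ((1 / 4) ^ c.1)) i]
    exact ENNReal.tsum_le_tsum hc
  have hsum' : ∑' n, kdiam (c n) ^ 2 ≤ 16 * η := hsum.trans (by gcongr)
  rw [zero_add]
  refine (iInf_le_of_le c <| iInf₂_le_of_le ?_ ?_ hsum').trans hηδ
  · intro g hg
    obtain ⟨k, hk⟩ := h𝒞 g hg
    exact mem_iUnion.2 ⟨e (k, tileLabel k g), by simpa [c] using hk⟩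
  · intro n
    rw [← ENNReal.pow_le_pow_left_iff two_ne_zero]
    exact ((ENNReal.le_tsum n).trans hsum').trans hηε

lemma tileContent_le_of_kdist_le {U : Set Hgrp} {k : ℕ}
    (hU : ∀ g ∈ U, ∀ g' ∈ U, kdist g g' ≤ (1 / 2) ^ k) :
    tileContent U ≤ 207 * ENNReal.ofReal ((1 / 4) ^ k) := by
  obtain ⟨s, hs, hmem⟩ := exists_tileLabel_finset hU
  have hcov : ∀ g ∈ U, ∃ j, (j, tileLabel j g) ∈ Prod.mk k '' (s : Set (ℤ × ℤ × ℤ)) :=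
    fun g hg => ⟨k, _, hmem g hg, rfl⟩
  refine (netContent_le hcov).trans ?_
  calc tileWeight (Prod.mk k '' (s : Set (ℤ × ℤ × ℤ)))
      = tileWeight (⋃ i ∈ s, {(k, i)}) := by congr 1; ext; simp [eq_comm]
    _ ≤ ∑ i ∈ s, tileWeight {(k, i)} := measure_biUnion_finset_le _ _
    _ = ∑ i ∈ s, ENNReal.ofReal ((1 / 4) ^ k) := by
        refine Finset.sum_congr rfl fun i _ => ?_
        rw [tileWeight_apply, tsum_eq_single (k, i)]
        · simp
        · intro c hc; simp [hc]
    _ = s.card * ENNReal.ofReal ((1 / 4) ^ k) := by simp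
    _ ≤ _ := by gcongr; exact_mod_cast hs

lemma tileContent_le_kdiam_sq {U : Set Hgrp} (hU : kdiam U ≤ 1) :
    tileContent U ≤ 828 * kdiam U ^ 2 := by
  have hfin : kdiam U ≠ ∞ := (hU.trans_lt ENNReal.one_lt_top).ne
  obtain ⟨d, hd0, hd⟩ : ∃ d : ℝ, 0 ≤ d ∧ kdiam U = ENNReal.ofReal d :=
    ⟨_, ENNReal.toReal_nonneg, (ENNReal.ofReal_toReal hfin).symm⟩
  have hdist : ∀ g ∈ U, ∀ g' ∈ U, kdist g g' ≤ d := fun g hg g' hg' =>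
    (ENNReal.ofReal_le_ofReal_iff hd0).1 (hd ▸ ofReal_kdist_le_kdiam hg hg')
  have hd1 : d ≤ 1 := by
    rwa [hd, ← ENNReal.ofReal_one, ENNReal.ofReal_le_ofReal_iff zero_le_one] at hU
  rcases hd0.eq_or_lt with rfl | hpos
  · have hlim : Tendsto (fun k : ℕ => 207 * ENNReal.ofReal ((1 / 4) ^ k)) atTop (𝓝 0) := by
      have h1 : Tendsto (fun k : ℕ => ENNReal.ofReal ((1 / 4) ^ k)) atTop (𝓝 0) := by
        simpa using (ENNReal.tendsto_ofReal (tendsto_pow_atTop_nhds_zero_of_lt_one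
          (by norm_num : (0 : ℝ) ≤ 1 / 4) (by norm_num)))
      simpa using ENNReal.Tendsto.const_mul h1 (Or.inr (by norm_num : (207 : ℝ≥0∞) ≠ ∞))
    refine (ge_of_tendsto' hlim fun k => ?_).trans zero_le
    exact tileContent_le_of_kdist_le fun g hg g' hg' => (hdist g hg g' hg').trans (by positivity)
  · obtain ⟨k, hk, hk'⟩ := exists_nat_pow_near_of_lt_one hpos hd1 (by norm_num : (0 : ℝ) < 1 / 2)
      (by norm_num)
    refine (tileContent_le_of_kdist_le fun g hg g' hg' => (hdist g hg g' hg').trans hk').trans ?_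
    have h4 : (1 / 4 : ℝ) ^ k ≤ 4 * d ^ 2 := by
      have : (1 / 4 : ℝ) ^ k = 4 * ((1 / 2) ^ (k + 1)) ^ 2 := by
        rw [pow_right_comm, show (1 / 2 : ℝ) ^ 2 = 1 / 4 by norm_num, pow_succ]; ring
      rw [this]
      gcongr
    calc 207 * ENNReal.ofReal ((1 / 4) ^ k) ≤ 207 * ENNReal.ofReal (4 * d ^ 2) := by gcongr
      _ = 828 * kdiam U ^ 2 := by
        rw [hd, ENNReal.ofReal_mul (by norm_num), ENNReal.ofReal_pow hd0, ← mul_assoc]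
        norm_num

/-! ### Contents computed with open covers -/

/-- The two-dimensional Hausdorff content of `S` at scale `δ`, computed with open covers. -/
def openContent (δ : ℝ≥0∞) (S : Set Hgrp) : ℝ≥0∞ :=
  ⨅ (c : ℕ → Set Hgrp) (_ : S ⊆ ⋃ n, c n) (_ : ∀ n, IsOpen (c n) ∧ kdiam (c n) ≤ δ),
    ∑' n, kdiam (c n) ^ 2

lemma openContent_le {δ : ℝ≥0∞} {S : Set Hgrp} {c : ℕ → Set Hgrp} (h : S ⊆ ⋃ n, c n)
    (hc : ∀ n, IsOpen (c n) ∧ kdiam (c n) ≤ δ) : openContent δ S ≤ ∑' n, kdiam (c n) ^ 2 :=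
  iInf_le_of_le c (iInf₂_le_of_le h hc le_rfl)

lemma openContent_mono {δ : ℝ≥0∞} {S T : Set Hgrp} (h : S ⊆ T) :
    openContent δ S ≤ openContent δ T :=
  le_iInf fun _ => le_iInf₂ fun hT hc => openContent_le (h.trans hT) hc

lemma exists_open_cover_lt {δ b : ℝ≥0∞} {S : Set Hgrp} (h : openContent δ S < b) :
    ∃ W, IsOpen W ∧ S ⊆ W ∧ openContent δ W < b := by
  simp only [openContent, iInf_lt_iff] at h
  obtain ⟨c, hS, hc, hlt⟩ := h
  exact ⟨_, isOpen_iUnion fun n => (hc n).1, hS, (openContent_le subset_rfl hc).trans_lt hlt⟩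

lemma tileContent_le_openContent (S : Set Hgrp) : tileContent S ≤ 828 * openContent 1 S := by
  have h828 : (828 : ℝ≥0∞) ≠ ∞ := by norm_num
  simp only [openContent, ENNReal.mul_iInf_of_ne (by norm_num : (828 : ℝ≥0∞) ≠ 0) h828]
  refine le_iInf fun c => le_iInf₂ fun hS hc => ?_
  calc tileContent S ≤ tileContent (⋃ n, c n) := tileContent_mono hS
    _ ≤ ∑' n, tileContent (c n) := netContent_iUnion_le c
    _ ≤ ∑' n, 828 * kdiam (c n) ^ 2 :=
        ENNReal.tsum_le_tsum fun n => tileContent_le_kdiam_sq (hc n).2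
    _ = _ := ENNReal.tsum_mul_left

lemma continuous_kdist_right (a : Hgrp) : Continuous (kdist a) := by
  have h : Continuous ((fun p : Hgrp × Hgrp => kdist p.1 p.2) ∘ fun g => (a, g)) :=
    Continuous.comp continuous_kdist (Continuous.prodMk_right a)
  exact h

lemma exists_isOpen_superset_kdiam_le (S : Set Hgrp) {η : ℝ} (hη : 0 < η) :
    ∃ W, IsOpen W ∧ S ⊆ W ∧ kdiam W ≤ kdiam S + ENNReal.ofReal (2 * η) := by
  refine ⟨⋃ a ∈ S, {g | kdist a g < η}, ?_, ?_, ?_⟩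
  · exact isOpen_biUnion fun a _ => isOpen_lt (continuous_kdist_right a) continuous_const
  · intro a ha
    have h : a ∈ {g | kdist a g < η} := (kdist_self a).trans_lt hη
    exact mem_biUnion ha h
  · rw [kdiam_le_iff]
    intro g hg g' hg'
    simp only [mem_iUnion, mem_ofPred_eq, exists_prop] at hg hg'
    obtain ⟨a, ha, hga⟩ := hg
    obtain ⟨b, hb, hgb⟩ := hg'
    have h : kdist g g' ≤ kdist a b + 2 * η := by
      have h1 := kdist_triangle g a g'
      have h2 := kdist_triangle a b g'
      rw [kdist_comm g a] at h1
      linarith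
    calc _ ≤ ENNReal.ofReal (kdist a b + 2 * η) := ENNReal.ofReal_le_ofReal h
      _ = ENNReal.ofReal (kdist a b) + ENNReal.ofReal (2 * η) :=
          ENNReal.ofReal_add (kdist_nonneg _ _) (by positivity)
      _ ≤ _ := by gcongr; exact ofReal_kdist_le_kdiam ha hb

lemma openContent_le_kHaus2 {δ : ℝ≥0∞} (hδ : 0 < δ) (hδ' : δ ≠ ∞) (S : Set Hgrp) :
    openContent δ S ≤ kHaus2 S := by
  refine le_trans ?_ (le_iSup₂ (δ / 2) (ENNReal.half_pos hδ.ne'))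
  refine le_iInf fun c => le_iInf₂ fun hS hc => ?_
  refine ENNReal.le_of_forall_pos_le_add fun ε hε _ => ?_
  obtain ⟨ε', hε', hsum⟩ := ENNReal.exists_pos_sum_of_countable (ENNReal.coe_pos.2 hε).ne' ℕ
  have hW : ∀ n, ∃ W, IsOpen W ∧ c n ⊆ W ∧ kdiam W ≤ δ ∧ kdiam W ^ 2 ≤ kdiam (c n) ^ 2 + ε' n := by
    intro n
    have hd : kdiam (c n) < δ := (hc n).trans_lt (ENNReal.half_lt_self hδ.ne' hδ')
    have hcont : Continuous fun t : ℝ => kdiam (c n) + ENNReal.ofReal (2 * t) :=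
      continuous_const.add (ENNReal.continuous_ofReal.comp (by fun_prop))
    have h1 : ∀ᶠ t in 𝓝 (0 : ℝ), kdiam (c n) + ENNReal.ofReal (2 * t) < δ :=
      hcont.tendsto 0 |>.eventually_lt_const (by simpa using hd)
    have h2 : ∀ᶠ t in 𝓝 (0 : ℝ),
        (kdiam (c n) + ENNReal.ofReal (2 * t)) ^ 2 < kdiam (c n) ^ 2 + ε' n := by
      refine ((ENNReal.continuous_pow 2).comp hcont).tendsto 0 |>.eventually_lt_const ?_
      simpa using ENNReal.lt_add_right (ENNReal.pow_ne_top hd.ne_top)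
        (ENNReal.coe_pos.2 (hε' n)).ne'
    obtain ⟨t, ⟨ht1, ht2⟩, ht⟩ := ((h1.and h2).filter_mono nhdsWithin_le_nhds |>.and
      (self_mem_nhdsWithin (s := Ioi (0 : ℝ)))).exists
    obtain ⟨W, hWo, hcW, hWd⟩ := exists_isOpen_superset_kdiam_le (c n) ht
    exact ⟨W, hWo, hcW, hWd.trans ht1.le, (by gcongr : kdiam W ^ 2 ≤ _).trans ht2.le⟩
  choose W hWo hcW hWδ hWs using hW
  calc openContent δ S ≤ ∑' n, kdiam (W n) ^ 2 :=
        openContent_le (hS.trans (iUnion_mono hcW)) fun n => ⟨hWo n, hWδ n⟩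
    _ ≤ ∑' n, (kdiam (c n) ^ 2 + ε' n) := ENNReal.tsum_le_tsum hWs
    _ = ∑' n, kdiam (c n) ^ 2 + ∑' n, (ε' n : ℝ≥0∞) := ENNReal.tsum_add
    _ ≤ _ := by gcongr

lemma kHaus2_eq_iSup_openContent (S : Set Hgrp) :
    kHaus2 S = ⨆ n : ℕ, openContent (↑(n + 1))⁻¹ S := by
  refine le_antisymm (iSup₂_le fun ε hε => ?_) (iSup_le fun n => openContent_le_kHaus2
    (by simp) (by simp) S)
  obtain ⟨n, hn⟩ := ENNReal.exists_inv_nat_lt hε.ne'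
  refine le_trans ?_ (le_iSup _ n)
  refine le_iInf fun c => le_iInf₂ fun hS hc => iInf_le_of_le c (iInf₂_le_of_le hS ?_ le_rfl)
  refine fun m => (hc m).2.trans (le_trans ?_ hn.le)
  gcongr
  exact n.le_succ

section Sections

variable {Y : Type*} [TopologicalSpace Y]

lemma isOpen_setOf_openContent_lt [T2Space Y] {F : Set (Y × Hgrp)} (hF : IsCompact F)
    (δ b : ℝ≥0∞) : IsOpen {v | openContent δ (Prod.mk v ⁻¹' F) < b} := by
  refine isOpen_iff_forall_mem_open.2 fun v hv => ?_
  obtain ⟨W, hW, hFW, hlt⟩ := exists_open_cover_lt hv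
  refine ⟨(Prod.fst '' (F ∩ Prod.snd ⁻¹' Wᶜ))ᶜ, fun w hw => ?_, ?_, ?_⟩
  · refine (openContent_mono fun g hg => ?_).trans_lt hlt
    by_contra hgW
    exact hw ⟨(w, g), ⟨hg, hgW⟩, rfl⟩
  · have : IsCompact (F ∩ Prod.snd ⁻¹' Wᶜ) :=
      hF.inter_right (hW.isClosed_compl.preimage continuous_snd)
    exact (this.image continuous_fst).isClosed.isOpen_compl
  · rintro ⟨⟨w, g⟩, ⟨hg, hgW⟩, rfl⟩
    exact hgW (hFW hg)

lemma measurable_openContent_section [T2Space Y] [MeasurableSpace Y] [OpensMeasurableSpace Y]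
    {F : Set (Y × Hgrp)} (hF : IsCompact F) (δ : ℝ≥0∞) :
    Measurable fun v => openContent δ (Prod.mk v ⁻¹' F) :=
  measurable_of_Iio fun b => (isOpen_setOf_openContent_lt hF δ b).measurableSet

lemma measurable_kHaus2_section [T2Space Y] [MeasurableSpace Y] [OpensMeasurableSpace Y]
    {F : Set (Y × Hgrp)} (hF : IsCompact F) : Measurable fun v => kHaus2 (Prod.mk v ⁻¹' F) := by
  simp only [kHaus2_eq_iSup_openContent]
  exact Measurable.iSup fun n => measurable_openContent_section hF _

lemma exists_openContent_section_lt [T2Space Y] {F : ℕ → Set (Y × Hgrp)} (hF : Antitone F)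
    (hFc : ∀ k, IsCompact (F k)) {δ b : ℝ≥0∞} {v : Y}
    (h : openContent δ (Prod.mk v ⁻¹' ⋂ k, F k) < b) :
    ∃ k, openContent δ (Prod.mk v ⁻¹' F k) < b := by
  obtain ⟨W, hW, hFW, hlt⟩ := exists_open_cover_lt h
  have hcl : ∀ k, IsClosed (Prod.mk v ⁻¹' F k) := fun k =>
    (hFc k).isClosed.preimage (by fun_prop)
  have hcpt : ∀ k, IsCompact (Prod.mk v ⁻¹' F k) := fun k =>
    ((hFc k).image continuous_snd).of_isClosed_subset (hcl k) fun g hg => ⟨(v, g), hg, rfl⟩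
  obtain ⟨k, hk⟩ := exists_subset_nhds_of_isCompact' (V := fun k => Prod.mk v ⁻¹' F k) (U := W)
    (directed_of_isDirected_le fun i j hij => preimage_mono (hF hij)) hcpt hcl
    (fun g hg => hW.mem_nhds (hFW (by simpa using hg)))
  exact ⟨k, (openContent_mono hk).trans_lt hlt⟩

end Sections

/-! ### Approximation of analytic sets by compact sets -/

lemma exists_subset_preimage_of_isCompact {D : ℕ → Set (ℕ → ℕ)} {n : ℕ → ℕ} (hD : Antitone D)
    (hDn : ∀ i, ∀ σ ∈ D (i + 1), σ i ≤ n i) {V : Set (ℕ → ℕ)} (hV : IsOpen V)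
    (hnV : univ.pi (fun i => Iic (n i)) ⊆ V) : ∃ k, D k ⊆ V := by
  by_contra! hcon
  choose σ hσ hσV using fun k => not_subset.1 (hcon k)
  have hcpt : IsCompact (univ.pi fun i => Iic (n i)) :=
    isCompact_univ_pi fun i => (finite_Iic (n i)).isCompact
  obtain ⟨τ, hτ, φ, hφ, hlim⟩ := hcpt.tendsto_subseq (x := fun k i => min (σ k i) (n i))
    fun k i _ => mem_Iic.2 (min_le_right _ _)
  have hlim' : Tendsto (fun j => σ (φ j)) atTop (𝓝 τ) := by
    rw [tendsto_pi_nhds] at hlim ⊢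
    intro i
    refine (hlim i).congr' ?_
    filter_upwards [eventually_ge_atTop (i + 1)] with j hj
    exact min_eq_left (hDn i _ (hD (hj.trans (hφ.id_le j)) (hσ (φ j))))
  obtain ⟨j, hj⟩ := (hlim'.eventually_mem (hV.mem_nhds (hnV hτ))).exists
  exact hσV _ hj

/-- Analytic sets are approximable from inside by compact sets, with respect to any monotone set
function which is continuous along increasing sequences. -/
theorem exists_isCompact_subset_of_lt {Z : Type*} [TopologicalSpace Z] [T2Space Z]
    {I : Set Z → ℝ≥0∞} (hI : ∀ S : ℕ → Set Z, Monotone S → I (⋃ n, S n) = ⨆ n, I (S n))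
    {A : Set Z} (hA : AnalyticSet A) {r : ℝ≥0∞} (hr : r < I A) :
    ∃ K, IsCompact K ∧ K ⊆ A ∧ ∃ F : ℕ → Set Z, Antitone F ∧ (∀ k, F k ⊆ A) ∧
      (∀ k, r < I (F k)) ∧ ⋂ k, closure (F k) ⊆ K := by
  rcases A.eq_empty_or_nonempty with rfl | hne
  · exact ⟨∅, isCompact_empty, subset_rfl, fun _ => ∅, antitone_const, fun _ => subset_rfl,
      fun _ => hr, by simp [iInter_const]⟩
  rw [AnalyticSet] at hA
  obtain ⟨g, hg, rfl⟩ := hA.resolve_left hne.ne_empty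
  have hstep : ∀ (k : ℕ) (D : {D : Set (ℕ → ℕ) // r < I (g '' D)}),
      ∃ m, r < I (g '' (D.1 ∩ {σ | σ k ≤ m})) := by
    rintro k ⟨D, hD⟩
    have hmono : Monotone fun m => g '' (D ∩ {σ | σ k ≤ m}) := fun a b hab =>
      image_mono (inter_subset_inter_right _ fun σ (hσ : σ k ≤ a) => hσ.trans hab)
    have hU : ⋃ m, g '' (D ∩ {σ | σ k ≤ m}) = g '' D := by
      rw [← image_iUnion, ← inter_iUnion]
      congr 1
      exact inter_eq_left.2 fun σ _ => mem_iUnion.2 ⟨σ k, le_refl (σ k)⟩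
    rw [← hU, hI _ hmono] at hD
    exact lt_iSup_iff.1 hD
  choose m hm using hstep
  let D : ℕ → {D : Set (ℕ → ℕ) // r < I (g '' D)} := fun k =>
    Nat.rec ⟨univ, by rwa [image_univ]⟩ (fun k D => ⟨_, hm k D⟩) k
  have hDs : ∀ k, (D (k + 1)).1 = (D k).1 ∩ {σ | σ k ≤ m k (D k)} := fun k => rfl
  have hDa : Antitone fun k => (D k).1 :=
    antitone_nat_of_succ_le fun k => (hDs k).le.trans inter_subset_left
  let P : Set (ℕ → ℕ) := univ.pi fun i => Iic (m i (D i))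
  have hP : IsCompact (g '' P) :=
    (isCompact_univ_pi fun i => (finite_Iic (m i (D i))).isCompact).image hg
  refine ⟨g '' P, hP, image_subset_range _ _, fun k => g '' (D k).1,
    fun a b hab => image_mono (hDa hab), fun k => image_subset_range _ _, fun k => (D k).2, ?_⟩
  intro z hz
  by_contra hzP
  obtain ⟨U, V, hU, hV, hzU, hPV, hdisj⟩ :=
    SeparatedNhds.of_isCompact_isCompact (isCompact_singleton (x := z)) hP
      (disjoint_singleton_left.2 hzP)
  obtain ⟨k, hk⟩ := exists_subset_preimage_of_isCompact hDa
    (fun i σ hσ => ((hDs i).le hσ).2) (hV.preimage hg) (image_subset_iff.1 hPV)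
  obtain ⟨w, hwU, hwD⟩ := mem_closure_iff.1 (mem_iInter.1 hz k) U hU (hzU rfl)
  exact disjoint_left.1 hdisj hwU (image_subset_iff.2 hk hwD)

section Dichotomy

variable {Y : Type*} [NormedAddCommGroup Y] [ProperSpace Y] [MeasurableSpace Y] [BorelSpace Y]
  {μ : Measure Y} [IsFiniteMeasure μ]

lemma ae_kHaus2_section_eq_zero_of_isBounded {B : Set (Y × Hgrp)} (hB : MeasurableSet B)
    (hbdd : Bornology.IsBounded B)
    (hK : ∀ K ⊆ B, IsCompact K → ∀ᵐ v ∂μ, kHaus2 (Prod.mk v ⁻¹' K) = 0) :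
    ∀ᵐ v ∂μ, kHaus2 (Prod.mk v ⁻¹' B) = 0 := by
  have key : ∀ b : ℝ≥0∞, 0 < b → μ {v | b < tileContent (Prod.mk v ⁻¹' B)} = 0 := by
    intro b hb
    by_contra hne
    obtain ⟨r, hr0, hr⟩ := exists_between (pos_iff_ne_zero.2 hne)
    have hI : ∀ S : ℕ → Set (Y × Hgrp), Monotone S →
        μ {v | b < tileContent (Prod.mk v ⁻¹' ⋃ n, S n)} =
          ⨆ n, μ {v | b < tileContent (Prod.mk v ⁻¹' S n)} := by
      intro S hS
      have hmono : Monotone fun n => {v | b < tileContent (Prod.mk v ⁻¹' S n)} :=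
        fun i j hij v hv => hv.trans_le (tileContent_mono (preimage_mono (hS hij)))
      rw [← hmono.measure_iUnion]
      congr 1
      ext v
      have hv : Monotone fun n => Prod.mk v ⁻¹' S n := fun i j hij => preimage_mono (hS hij)
      simp only [preimage_iUnion, tileContent_iUnion_of_monotone hv, lt_iSup_iff, mem_ofPred_eq,
        mem_iUnion]
    obtain ⟨K, hKc, hKB, F, hF, hFB, hFr, hFK⟩ := exists_isCompact_subset_of_lt
      (I := fun S => μ {v | b < tileContent (Prod.mk v ⁻¹' S)}) hI hB.analyticSet hr
    have hFc : ∀ k, IsCompact (closure (F k)) := fun k =>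
      (hbdd.subset (hFB k)).isCompact_closure
    have hFa : Antitone fun k => closure (F k) := fun i j hij => closure_mono (hF hij)
    let T : ℕ → Set Y := fun k => {v | b ≤ 828 * openContent 1 (Prod.mk v ⁻¹' closure (F k))}
    have hTm : ∀ k, MeasurableSet (T k) := fun k =>
      measurableSet_le measurable_const ((measurable_openContent_section (hFc k) 1).const_mul _)
    have hTa : Antitone T := fun i j hij v (hv : b ≤ _) =>
      hv.trans (mul_le_mul_right (openContent_mono (preimage_mono (hFa hij))) _)
    have hTr : r ≤ μ (⋂ k, T k) := by
      rw [hTa.measure_iInter (fun k => (hTm k).nullMeasurableSet) ⟨0, measure_ne_top _ _⟩]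
      refine le_iInf fun k => (hFr k).le.trans (measure_mono fun v hv => ?_)
      exact (le_of_lt hv).trans ((tileContent_mono (preimage_mono subset_closure)).trans
        (tileContent_le_openContent _))
    refine (hr0.trans_le (hTr.trans (measure_mono fun v hv => ?_))).ne'
      (ae_iff.1 (hK K hKB hKc))
    intro h0
    have hz : openContent 1 (Prod.mk v ⁻¹' ⋂ k, closure (F k)) < b / 828 := by
      refine (openContent_le_kHaus2 zero_lt_one ENNReal.one_ne_top _).trans_lt ?_
      refine (kHaus2_mono (preimage_mono hFK)).trans_lt ?_
      rw [h0]
      exact ENNReal.div_pos hb.ne' (by norm_num)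
    obtain ⟨k, hk⟩ := exists_openContent_section_lt hFa hFc hz
    have hbk : b ≤ _ := mem_iInter.1 hv k
    refine hbk.not_gt ?_
    rw [mul_comm]
    exact (ENNReal.lt_div_iff_mul_lt (by norm_num) (by norm_num)).1 hk
  have hall : ∀ᵐ v ∂μ, ∀ n : ℕ, tileContent (Prod.mk v ⁻¹' B) ≤ (n : ℝ≥0∞)⁻¹ := by
    rw [ae_all_iff]
    intro n
    rw [ae_iff]
    simpa only [not_le] using key (n : ℝ≥0∞)⁻¹ (by simp)
  filter_upwards [hall] with v hv
  exact kHaus2_eq_zero_of_tileContent_eq_zero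
    (le_antisymm (ge_of_tendsto' ENNReal.tendsto_inv_nat_nhds_zero hv) zero_le)

lemma ae_kHaus2_section_eq_zero {B : Set (Y × Hgrp)} (hB : MeasurableSet B)
    (hK : ∀ K ⊆ B, IsCompact K → ∀ᵐ v ∂μ, kHaus2 (Prod.mk v ⁻¹' K) = 0) :
    ∀ᵐ v ∂μ, kHaus2 (Prod.mk v ⁻¹' B) = 0 := by
  have h : ∀ n : ℕ, ∀ᵐ v ∂μ, kHaus2 (Prod.mk v ⁻¹' (B ∩ Metric.closedBall 0 n)) = 0 := fun n =>
    ae_kHaus2_section_eq_zero_of_isBounded (hB.inter measurableSet_closedBall)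
      (Metric.isBounded_closedBall.subset inter_subset_right)
      fun K hKB => hK K (hKB.trans inter_subset_left)
  filter_upwards [ae_all_iff.2 h] with v hv
  have hU : B = ⋃ n : ℕ, B ∩ Metric.closedBall 0 n := by
    rw [← inter_iUnion, Metric.iUnion_closedBall_nat, inter_univ]
  rw [hU, preimage_iUnion]
  exact le_antisymm ((kHaus2_iUnion_le _).trans (by simp only [hv, tsum_zero, le_refl])) zero_le

end Dichotomy

/-! ### Measurability of the Hausdorff measure of sections -/

lemma kMeasure_section {Y : Type*} [MeasurableSpace Y] {S : Set (Y × Hgrp)}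
    (hS : MeasurableSet S) (v : Y) : kMeasure (Prod.mk v ⁻¹' S) = kHaus2 (Prod.mk v ⁻¹' S) :=
  kMeasure_apply (measurable_prodMk_left hS)

section Measurability

variable {Y : Type*} [NormedAddCommGroup Y] [MeasurableSpace Y] [BorelSpace Y]

lemma IsSigmaCompact.measurable_kHaus2_section {S : Set (Y × Hgrp)} (hS : IsSigmaCompact S) :
    Measurable fun v => kHaus2 (Prod.mk v ⁻¹' S) := by
  obtain ⟨K, hK, rfl⟩ := hS
  have hc : ∀ n, IsCompact (accumulate K n) := isCompact_accumulate hK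
  have h : ∀ v, kHaus2 (Prod.mk v ⁻¹' ⋃ n, K n) = ⨆ n, kHaus2 (Prod.mk v ⁻¹' accumulate K n) := by
    intro v
    rw [← iUnion_accumulate, ← kMeasure_section (.iUnion fun n => (hc n).measurableSet),
      preimage_iUnion, Monotone.measure_iUnion fun i j hij =>
        preimage_mono (monotone_accumulate hij)]
    exact iSup_congr fun n => kMeasure_section (hc n).measurableSet v
  simp only [h]
  exact Measurable.iSup fun n => _root_.measurable_kHaus2_section (hc n)

lemma IsSigmaCompact.measurableSet_of_t2 {Z : Type*} [TopologicalSpace Z] [T2Space Z]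
    [MeasurableSpace Z] [OpensMeasurableSpace Z] {S : Set Z} (hS : IsSigmaCompact S) :
    MeasurableSet S := by
  obtain ⟨K, hK, rfl⟩ := hS
  exact .iUnion fun n => (hK n).measurableSet

variable {μ : Measure Y} [IsFiniteMeasure μ]

/-- Among the `σ`-compact subsets of a given set there is one whose sections have maximal
Hausdorff measure. -/
lemma exists_isSigmaCompact_subset_maximal (A : Set (Y × Hgrp)) :
    ∃ L ⊆ A, IsSigmaCompact L ∧ ∀ K ⊆ A, IsCompact K →
      ∀ᵐ v ∂μ, kHaus2 (Prod.mk v ⁻¹' (L ∪ K)) = kHaus2 (Prod.mk v ⁻¹' L) := by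
  let J : Set (Y × Hgrp) → ℝ≥0∞ := fun S => ∫⁻ v, (1 + kHaus2 (Prod.mk v ⁻¹' S))⁻¹ ∂μ
  have hJ : Antitone J := fun S T hST => lintegral_mono fun v =>
    ENNReal.inv_le_inv.2 (add_le_add le_rfl (kHaus2_mono (preimage_mono hST)))
  have hJfin : ∀ S, J S ≠ ∞ := fun S => by
    refine ((lintegral_mono fun v => ?_ : J S ≤ ∫⁻ _, 1 ∂μ).trans_lt ?_).ne
    · exact ENNReal.inv_le_one.2 le_self_add
    · simp [measure_lt_top]
  obtain ⟨j, -, hjlim, hj⟩ := exists_seq_tendsto_sInf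
    (S := J '' {S | S ⊆ A ∧ IsSigmaCompact S}) ⟨_, ∅, ⟨empty_subset _, isSigmaCompact_empty⟩, rfl⟩
    (OrderBot.bddBelow _)
  choose S hS hSj using hj
  have hL : IsSigmaCompact (⋃ n, S n) := isSigmaCompact_iUnion _ fun n => (hS n).2
  refine ⟨⋃ n, S n, iUnion_subset fun n => (hS n).1, hL, fun K hK hKc => ?_⟩
  set L := ⋃ n, S n with hLdef
  have hLK : IsSigmaCompact (L ∪ K) := by
    rw [union_eq_iUnion]
    exact isSigmaCompact_iUnion _ (Bool.forall_bool.2 ⟨hKc.isSigmaCompact, hL⟩)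
  have hle : J L ≤ J (L ∪ K) := by
    refine (ge_of_tendsto' hjlim fun n => ?_).trans (csInf_le (OrderBot.bddBelow _) ⟨L ∪ K,
      ⟨union_subset (iUnion_subset fun n => (hS n).1) hK, hLK⟩, rfl⟩)
    rw [← hSj n]
    exact hJ (subset_iUnion S n)
  have hmeas : ∀ {S : Set (Y × Hgrp)}, IsSigmaCompact S →
      Measurable fun v => (1 + kHaus2 (Prod.mk v ⁻¹' S))⁻¹ := fun hS =>
    (measurable_const.add hS.measurable_kHaus2_section).inv
  have hae := ae_eq_of_ae_le_of_lintegral_le (μ := μ) (.of_forall fun v =>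
    ENNReal.inv_le_inv.2 (add_le_add le_rfl (kHaus2_mono (preimage_mono subset_union_left))))
    (hJfin (L ∪ K)) (hmeas hL).aemeasurable hle
  filter_upwards [hae] with v hv
  exact (ENNReal.add_right_inj ENNReal.one_ne_top).1 (inv_injective hv)

variable [ProperSpace Y]

/-- The Hausdorff measure of the sections of a Borel set is an almost everywhere measurable
function, with respect to any finite measure. -/
theorem aemeasurable_kHaus2_section_of_isFiniteMeasure {A : Set (Y × Hgrp)}
    (hA : MeasurableSet A) : AEMeasurable (fun v => kHaus2 (Prod.mk v ⁻¹' A)) μ := by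
  obtain ⟨L, hLA, hL, hmax⟩ := exists_isSigmaCompact_subset_maximal (μ := μ) A
  have hLm : MeasurableSet L := hL.measurableSet_of_t2
  have hfin : MeasurableSet {v | kHaus2 (Prod.mk v ⁻¹' L) < ∞} :=
    measurableSet_lt hL.measurable_kHaus2_section measurable_const
  have hdiff : ∀ᵐ v ∂μ.restrict {v | kHaus2 (Prod.mk v ⁻¹' L) < ∞},
      kHaus2 (Prod.mk v ⁻¹' (A \ L)) = 0 := by
    refine ae_kHaus2_section_eq_zero (hA.diff hLm) fun K hK hKc => ?_
    rw [ae_restrict_iff' hfin]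
    filter_upwards [hmax K (hK.trans sdiff_subset) hKc] with v hv hvfin
    have hd : Disjoint (Prod.mk v ⁻¹' L) (Prod.mk v ⁻¹' K) :=
      disjoint_left.2 fun g hg hg' => (hK hg').2 hg
    rw [← kMeasure_section (hLm.union hKc.measurableSet), preimage_union,
      measure_union hd (measurable_prodMk_left hKc.measurableSet), kMeasure_section hLm,
      kMeasure_section hKc.measurableSet] at hv
    exact (ENNReal.add_right_inj hvfin.ne).1 (hv.trans (add_zero _).symm)
  rw [ae_restrict_iff' hfin] at hdiff
  refine ⟨_, hL.measurable_kHaus2_section, ?_⟩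
  filter_upwards [hdiff] with v hv
  refine le_antisymm ?_ (kHaus2_mono (preimage_mono hLA))
  by_cases hvfin : kHaus2 (Prod.mk v ⁻¹' L) < ∞
  · rw [← kMeasure_section hA, ← kMeasure_section hLm]
    calc kMeasure (Prod.mk v ⁻¹' A)
        ≤ kMeasure (Prod.mk v ⁻¹' L) + kMeasure (Prod.mk v ⁻¹' (A \ L)) := by
          refine (measure_mono ?_).trans (measure_union_le _ _)
          rw [← preimage_union, union_sdiff_self]
          exact preimage_mono subset_union_right
      _ = _ := by rw [kMeasure_section (hA.diff hLm), hv hvfin, add_zero]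
  · rw [not_lt_top_iff.1 hvfin]
    exact le_top

theorem aemeasurable_kHaus2_section {ν : Measure Y} [SFinite ν] {A : Set (Y × Hgrp)}
    (hA : MeasurableSet A) : AEMeasurable (fun v => kHaus2 (Prod.mk v ⁻¹' A)) ν :=
  (aemeasurable_kHaus2_section_of_isFiniteMeasure (μ := ν.toFinite) hA).mono_ac
    (absolutelyContinuous_toFinite ν)

end Measurability

/-! ### The graph of the horizontal gradient -/

/-- The limit at `0` along the rationals different from `0`. -/
def ratPunctured : Filter ℚ := comap ((↑) : ℚ → ℝ) (𝓝[≠] 0)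

instance : ratPunctured.IsCountablyGenerated := by
  unfold ratPunctured; infer_instance

lemma tendsto_punctured_iff_rat {φ : ℝ → ℝ} (hφ : ∀ᶠ l in 𝓝[≠] (0 : ℝ), ContinuousAt φ l)
    {a : ℝ} :
    Tendsto φ (𝓝[≠] 0) (𝓝 a) ↔ Tendsto (fun q : ℚ => φ q) ratPunctured (𝓝 a) := by
  refine ⟨fun h => h.comp tendsto_comap, fun h => ?_⟩
  refine (closed_nhds_basis a).tendsto_right_iff.2 fun C hC => ?_
  have hq : ∀ᶠ l in 𝓝[≠] (0 : ℝ), ∀ q : ℚ, (q : ℝ) = l → φ q ∈ C :=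
    eventually_comap.1 (h hC.1)
  rw [eventually_nhdsWithin_iff] at hφ hq
  rw [eventually_nhdsWithin_iff]
  filter_upwards [hφ, hq.eventually_nhds] with l hc hl hl0
  have hl' : ∀ᶠ l' in 𝓝 l, ∀ q : ℚ, (q : ℝ) = l' → φ q ∈ C := by
    filter_upwards [hl, isOpen_compl_singleton.mem_nhds hl0] with l' h1 h2 using h1 h2
  have hmem : l ∈ closure {l' | ∃ q : ℚ, (q : ℝ) = l' ∧ φ q ∈ C} := by
    rw [mem_closure_iff_nhds]
    intro t ht
    obtain ⟨l', hl't, q, rfl⟩ := (mem_closure_iff_nhds.1 (Rat.denseRange_cast (𝕜 := ℝ) l)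
      _ (inter_mem ht hl'))
    exact ⟨q, hl't.1, q, rfl, hl't.2 q rfl⟩
  have := (hc hl0).continuousWithinAt.mem_closure hmem (t := C) (by rintro _ ⟨q, rfl, h⟩; exact h)
  rwa [hC.2.closure_eq] at this

section Quotient

variable {Ω : Set Hgrp} {u : Hgrp → ℝ} {w : ℝ → Hgrp}

lemma continuousOn_of_abs_sub_le_kdist {L : ℝ}
    (hlip : ∀ a ∈ Ω, ∀ b ∈ Ω, |u a - u b| ≤ L * kdist a b) : ContinuousOn u Ω := by
  intro a ha
  have h : Tendsto (fun b => L * kdist a b) (𝓝[Ω] a) (𝓝 0) := by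
    have h1 := ((continuous_kdist_right a).const_mul L).tendsto a
    simp only [kdist_self, mul_zero] at h1
    exact h1.mono_left nhdsWithin_le_nhds
  refine tendsto_iff_dist_tendsto_zero.2 (squeeze_zero' (.of_forall fun _ => dist_nonneg) ?_ h)
  filter_upwards [self_mem_nhdsWithin] with b hb
  rw [dist_comm]
  exact hlip a ha b hb

lemma continuous_hmul : Continuous fun p : Hgrp × Hgrp => hmul p.1 p.2 := by
  unfold hmul; fun_prop

lemma hmul_zero (g : Hgrp) : hmul g 0 = g := by simp [hmul]

lemma eventually_hmul_mem (hΩ : IsOpen Ω) {g : Hgrp} (hg : g ∈ Ω) (hw : Continuous w)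
    (hw0 : w 0 = 0) : ∀ᶠ l in 𝓝[≠] (0 : ℝ), hmul g (w l) ∈ Ω := by
  have hc : Continuous fun l => hmul g (w l) :=
    Continuous.comp continuous_hmul (continuous_const.prodMk hw)
  refine (hc.tendsto 0).mono_left nhdsWithin_le_nhds |>.eventually_mem (hΩ.mem_nhds ?_)
  rwa [hw0, hmul_zero]

lemma tendsto_quotient_iff_rat (hΩ : IsOpen Ω) (hu : ContinuousOn u Ω) {g : Hgrp} (hg : g ∈ Ω)
    (hw : Continuous w) (hw0 : w 0 = 0) {a : ℝ} :
    Tendsto (fun l : ℝ => (u (hmul g (w l)) - u g) / l) (𝓝[≠] 0) (𝓝 a) ↔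
      Tendsto (fun q : ℚ => (Ω.indicator u (hmul g (w q)) - Ω.indicator u g) / q)
        ratPunctured (𝓝 a) := by
  have hmem := eventually_hmul_mem hΩ hg hw hw0
  rw [tendsto_punctured_iff_rat]
  · refine tendsto_congr' ?_
    filter_upwards [hmem.comap ((↑) : ℚ → ℝ)] with q hq
    rw [indicator_of_mem hq, indicator_of_mem hg]
  · filter_upwards [hmem, self_mem_nhdsWithin] with l hl hl0
    have h1 : ContinuousAt (fun l => hmul g (w l)) l :=
      (Continuous.comp continuous_hmul (continuous_const.prodMk hw)).continuousAt
    exact ((ContinuousAt.comp (f := fun l => hmul g (w l))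
      (hu.continuousAt (hΩ.mem_nhds hl)) h1).sub_const _).div continuousAt_id hl0

lemma measurableSet_tendsto_quotient (hΩ : IsOpen Ω) (hu : ContinuousOn u Ω) {p : ℝ × ℝ → ℝ}
    (hp : Measurable p) (w : ℝ → Hgrp) :
    MeasurableSet {x : (ℝ × ℝ) × Hgrp |
      Tendsto (fun q : ℚ => (Ω.indicator u (hmul x.2 (w q)) - Ω.indicator u x.2) / q)
        ratPunctured (𝓝 (p x.1))} := by
  classical
  have hum : Measurable (Ω.indicator u) := by
    rw [← piecewise_eq_indicator]
    exact hu.measurable_piecewise continuousOn_const hΩ.measurableSet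
  refine measurableSet_tendsto_fun (fun q => ?_) (hp.comp measurable_fst)
  have hc : Continuous fun x : (ℝ × ℝ) × Hgrp => hmul x.2 (w q) :=
    Continuous.comp continuous_hmul (continuous_snd.prodMk continuous_const)
  exact ((hum.comp hc.measurable).sub (hum.comp measurable_snd)).div_const _

end Quotient

lemma xuVal_eq {u : Hgrp → ℝ} {g : Hgrp} {a : ℝ}
    (h : Tendsto (XdiffQuot u g) (𝓝[≠] 0) (𝓝 a)) : XuVal u g = a := by
  have hex : XlimExists u g := ⟨a, h⟩
  rw [XuVal, dif_pos hex]
  exact tendsto_nhds_unique hex.choose_spec h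

lemma yuVal_eq {u : Hgrp → ℝ} {g : Hgrp} {a : ℝ}
    (h : Tendsto (YdiffQuot u g) (𝓝[≠] 0) (𝓝 a)) : YuVal u g = a := by
  have hex : YlimExists u g := ⟨a, h⟩
  rw [YuVal, dif_pos hex]
  exact tendsto_nhds_unique hex.choose_spec h

lemma mem_sigmaSet_iff {Ω E : Set Hgrp} (hE : E ⊆ Ω) {u : Hgrp → ℝ} {v : ℝ × ℝ} {g : Hgrp} :
    g ∈ SigmaSet Ω u E v ↔ g ∈ E ∧ Tendsto (XdiffQuot u g) (𝓝[≠] 0) (𝓝 v.1) ∧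
      Tendsto (YdiffQuot u g) (𝓝[≠] 0) (𝓝 v.2) := by
  constructor
  · rintro ⟨⟨hg, -, ⟨a, ha⟩, ⟨b, hb⟩⟩, rfl⟩
    rw [XXgrad, xuVal_eq ha, yuVal_eq hb]
    exact ⟨hg, ha, hb⟩
  · rintro ⟨hg, hx, hy⟩
    exact ⟨⟨hg, hE hg, ⟨_, hx⟩, ⟨_, hy⟩⟩, Prod.ext (xuVal_eq hx) (yuVal_eq hy)⟩

/-- The level sets of the horizontal gradient are the sections of a Borel set. -/
lemma exists_measurableSet_section_eq_sigmaSet {Ω E : Set Hgrp} {u : Hgrp → ℝ} (hΩ : IsOpen Ω)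
    (hu : ContinuousOn u Ω) (hE : E ⊆ Ω) (hEm : MeasurableSet E) :
    ∃ A : Set ((ℝ × ℝ) × Hgrp), MeasurableSet A ∧ ∀ v, Prod.mk v ⁻¹' A = SigmaSet Ω u E v := by
  refine ⟨_, (measurable_snd hEm).inter
    ((measurableSet_tendsto_quotient hΩ hu measurable_fst fun l => (l, 0, 0)).inter
      (measurableSet_tendsto_quotient hΩ hu measurable_snd fun l => (0, l, 0))), fun v => ?_⟩
  ext g
  rw [mem_sigmaSet_iff hE]
  refine and_congr_right fun hg => and_congr ?_ ?_
  · exact (tendsto_quotient_iff_rat (w := fun l => (l, 0, 0)) hΩ hu (hE hg) (by fun_prop)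
      (by simp)).symm
  · exact (tendsto_quotient_iff_rat (w := fun l => (0, l, 0)) hΩ hu (hE hg) (by fun_prop)
      (by simp)).symm

lemma sigmaSet_iUnion (Ω : Set Hgrp) (u : Hgrp → ℝ) (E : ℕ → Set Hgrp) (v : ℝ × ℝ) :
    SigmaSet Ω u (⋃ i, E i) v = ⋃ i, SigmaSet Ω u (E i) v := by
  ext g
  constructor
  · rintro ⟨⟨hg, hD⟩, hv⟩
    obtain ⟨i, hi⟩ := mem_iUnion.1 hg
    exact mem_iUnion.2 ⟨i, ⟨hi, hD⟩, hv⟩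
  · intro hg
    obtain ⟨i, ⟨hi, hD⟩, hv⟩ := mem_iUnion.1 hg
    exact ⟨⟨mem_iUnion.2 ⟨i, hi⟩, hD⟩, hv⟩

/-- the Monge–Ampère set function
`ν_u(E) = ∫_{ℝ²} 𝓗²_ρ({g ∈ E ∩ D : 𝕏u(g) = v}) dv` of a Korányi-Lipschitz function is
nonnegative and countably additive on pairwise disjoint sequences of Borel sets. -/
theorem stmt18 (Ω : Set Hgrp) (hΩo : IsOpen Ω) (u : Hgrp → ℝ) (L : ℝ)
    (hlip : ∀ a ∈ Ω, ∀ b ∈ Ω, |u a - u b| ≤ L * kdist a b) :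
    (∀ E : Set Hgrp, 0 ≤ nuMA Ω u E) ∧
    (∀ E : ℕ → Set Hgrp, (∀ i, MeasurableSet (E i)) → (∀ i, E i ⊆ Ω) →
      Pairwise (Function.onFun Disjoint E) →
      nuMA Ω u (⋃ i, E i) = ∑' i, nuMA Ω u (E i)) := by
  refine ⟨fun E => zero_le, fun E hEm hE hdisj => ?_⟩
  have hu := continuousOn_of_abs_sub_le_kdist hlip
  choose A hAm hA using fun i =>
    exists_measurableSet_section_eq_sigmaSet hΩo hu (hE i) (hEm i)
  simp only [nuMA]
  rw [← lintegral_tsum fun i => by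
    simpa only [hA] using aemeasurable_kHaus2_section (ν := volume) (hAm i)]
  refine lintegral_congr fun v => ?_
  have hm : ∀ i, MeasurableSet (SigmaSet Ω u (E i) v) := fun i =>
    hA i v ▸ measurable_prodMk_left (hAm i)
  have hd : Pairwise (Function.onFun Disjoint fun i => SigmaSet Ω u (E i) v) :=
    fun i j hij => (hdisj hij).mono (fun _ h => h.1.1) fun _ h => h.1.1
  rw [sigmaSet_iUnion, ← kMeasure_apply (.iUnion hm), measure_iUnion hd hm]
  exact tsum_congr fun i => kMeasure_apply (hm i)
end
end

section
/- Let z : ℝ → ℝ be twice continuously differentiable and positive, and define v : ℍ → ℝ by v(x,y,t) = ((x²+y²)² + z(t))^{1/4}. Then v is H-convex on ℍ if and only if 4 z(t)(1 + z''(t)) ≥ 3 (z'(t))² for every t ∈ ℝ. -/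
noncomputable section

open Filter Topology Set
open scoped ENNReal

section RpowConvexity

variable {N N' N'' : ℝ → ℝ}

theorem hasDerivAt_rpow_quarter (hN : ∀ s, HasDerivAt N (N' s) s) (hpos : ∀ s, 0 < N s) (s : ℝ) :
    HasDerivAt (fun s => N s ^ ((1:ℝ)/4)) (1 / 4 * N' s * N s ^ (-(3:ℝ)/4)) s := by
  convert (hN s).rpow_const (p := (1:ℝ)/4) (Or.inl (hpos s).ne') using 1
  rw [show (1:ℝ)/4 - 1 = -3/4 by norm_num]
  ring

theorem hasDerivAt_deriv_rpow_quarter (hN : ∀ s, HasDerivAt N (N' s) s)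
    (hN' : ∀ s, HasDerivAt N' (N'' s) s) (hpos : ∀ s, 0 < N s) (s : ℝ) :
    HasDerivAt (fun s => 1 / 4 * N' s * N s ^ (-(3:ℝ)/4))
      (1 / 16 * N s ^ (-(7:ℝ)/4) * (4 * N s * N'' s - 3 * N' s ^ 2)) s := by
  refine (((hN' s).const_mul (1 / 4)).fun_mul
    ((hN s).rpow_const (p := -(3:ℝ)/4) (Or.inl (hpos s).ne'))).congr_deriv ?_
  have h : N s ^ (-(3:ℝ)/4) = N s ^ (-(7:ℝ)/4) * N s := by
    rw [← Real.rpow_add_one (hpos s).ne']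
    norm_num
  rw [show -(3:ℝ)/4 - 1 = -7/4 by norm_num, h]
  ring

/-- The fourth root of a positive function is convex iff `4 N N'' ≥ 3 N'²`. -/
theorem convexOn_rpow_quarter_iff (hN : ∀ s, HasDerivAt N (N' s) s)
    (hN' : ∀ s, HasDerivAt N' (N'' s) s) (hpos : ∀ s, 0 < N s) :
    ConvexOn ℝ univ (fun s => N s ^ ((1:ℝ)/4)) ↔ ∀ s, 3 * N' s ^ 2 ≤ 4 * N s * N'' s := by
  have h1 := hasDerivAt_rpow_quarter hN hpos
  have h2 := hasDerivAt_deriv_rpow_quarter hN hN' hpos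
  have hd : deriv (fun s => N s ^ ((1:ℝ)/4)) = fun s => 1 / 4 * N' s * N s ^ (-(3:ℝ)/4) :=
    funext fun s => (h1 s).deriv
  have hc : ∀ s, 0 < 1 / 16 * N s ^ (-(7:ℝ)/4) := fun s =>
    mul_pos (by norm_num) (Real.rpow_pos_of_pos (hpos s) _)
  constructor
  · intro h s
    have hm := h.monotoneOn_deriv fun s _ => (h1 s).differentiableAt
    rw [hd, monotoneOn_univ] at hm
    have h0 : 0 ≤ deriv (fun s => 1 / 4 * N' s * N s ^ (-(3:ℝ)/4)) s := hm.deriv_nonneg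
    rw [(h2 s).deriv] at h0
    linarith [nonneg_of_mul_nonneg_right h0 (hc s)]
  · intro h
    refine convexOn_univ_of_deriv2_nonneg (fun s => (h1 s).differentiableAt)
      (hd ▸ fun s => (h2 s).differentiableAt) fun s => ?_
    rw [Function.iterate_succ, Function.iterate_one, Function.comp_apply, hd, (h2 s).deriv]
    exact mul_nonneg (hc s).le (by linarith [h s])

end RpowConvexity

/-- A function on `ℍ` is H-convex iff it is convex along every horizontal line. -/
theorem hConvexOn_univ_iff_convexOn_lines (u : Hgrp → ℝ) :
    HConvexOn univ u ↔ ∀ x y t a b : ℝ, ConvexOn ℝ univ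
      fun s : ℝ => u (x + s * a, y + s * b, t + s * (2 * (a * y - x * b))) := by
  constructor
  · intro h x y t a b
    refine ⟨convex_univ, fun r _ s _ k l _ hl hkl => ?_⟩
    obtain rfl : k = 1 - l := by linarith
    have := h (x + r * a, y + r * b, t + r * (2 * (a * y - x * b))) trivial
      (x + s * a, y + s * b, t + s * (2 * (a * y - x * b)))
      ⟨by simp only [hplane, mem_ofPred_eq]; ring, trivial⟩ l ⟨hl, by linarith⟩
    simp only [smul_eq_mul]
    refine (le_of_eq ?_).trans (this.trans (le_of_eq (by ring)))
    congr 1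
    simp only [hmul, hdil, hinv, Prod.mk.injEq]
    refine ⟨?_, ?_, ?_⟩ <;> ring
  · rintro h ⟨x, y, t⟩ - ⟨x', y', t'⟩ ⟨hg, -⟩ l ⟨hl, hl1⟩
    simp only [hplane, mem_ofPred_eq] at hg
    have := (h x y t (x' - x) (y' - y)).2 (mem_univ 0) (mem_univ 1)
      (sub_nonneg.2 hl1) hl (by ring)
    simp only [smul_eq_mul] at this
    calc _ = _ := ?_
      _ ≤ _ := this
      _ = _ := ?_
    · congr 1
      simp only [hmul, hdil, hinv, Prod.mk.injEq, hg]
      refine ⟨?_, ?_, ?_⟩ <;> ring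
    · rw [show ((x + 0 * (x' - x), y + 0 * (y' - y),
          t + 0 * (2 * ((x' - x) * y - x * (y' - y)))) : Hgrp) = (x, y, t) by simp,
        show ((x + 1 * (x' - x), y + 1 * (y' - y),
          t + 1 * (2 * ((x' - x) * y - x * (y' - y)))) : Hgrp) = (x', y', t') by
            simp only [Prod.mk.injEq, hg]; refine ⟨?_, ?_, ?_⟩ <;> ring]
      ring

/-- Convexity of `((x²+y²)² + z(t))^{1/4}` along a horizontal line, as a pointwise inequality. -/
theorem convexOn_line_iff {z : ℝ → ℝ} (hz : ContDiff ℝ 2 z) (hzpos : ∀ t, 0 < z t)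
    (x y t a b : ℝ) :
    ConvexOn ℝ univ (fun s : ℝ => (((x + s * a) ^ 2 + (y + s * b) ^ 2) ^ 2 +
        z (t + s * (2 * (a * y - x * b)))) ^ ((1:ℝ)/4)) ↔
      ∀ s : ℝ, 3 * (4 * ((x + s * a) ^ 2 + (y + s * b) ^ 2) *
            ((x + s * a) * a + (y + s * b) * b) +
          2 * (a * y - x * b) * deriv z (t + s * (2 * (a * y - x * b)))) ^ 2 ≤
        4 * (((x + s * a) ^ 2 + (y + s * b) ^ 2) ^ 2 + z (t + s * (2 * (a * y - x * b)))) *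
          (12 * ((x + s * a) * a + (y + s * b) * b) ^ 2 +
            4 * (a * y - x * b) ^ 2 * (1 + deriv (deriv z) (t + s * (2 * (a * y - x * b))))) := by
  have hz1 : ∀ t, HasDerivAt z (deriv z t) t := fun t =>
    (hz.differentiable (by norm_num) t).hasDerivAt
  have hz2 : ∀ t, HasDerivAt (deriv z) (deriv (deriv z) t) t := fun t =>
    (hz.differentiable_deriv_two t).hasDerivAt
  have hlin : ∀ p c s : ℝ, HasDerivAt (fun s => p + s * c) c s := fun p c s => by
    simpa using ((hasDerivAt_id s).mul_const c).const_add p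
  refine convexOn_rpow_quarter_iff (fun s => ?_) (fun s => ?_) fun s => ?_
  · refine (((((hlin x a s).fun_pow 2).fun_add ((hlin y b s).fun_pow 2)).fun_pow 2).fun_add
      ((hz1 _).comp s (hlin t (2 * (a * y - x * b)) s))).congr_deriv ?_
    norm_num
    ring
  · refine (((((hlin x a s).fun_pow 2).fun_add ((hlin y b s).fun_pow 2)).const_mul 4 |>.fun_mul
      (((hlin x a s).mul_const a).fun_add ((hlin y b s).mul_const b))).fun_add
      (((hz2 _).comp s (hlin t (2 * (a * y - x * b)) s)).const_mul
        (2 * (a * y - x * b)))).congr_deriv ?_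
    norm_num
    ring
  · have := hzpos (t + s * (2 * (a * y - x * b)))
    positivity

/-- The Cauchy–Schwarz step: `z'²/z` controls the mixed term `(2qα + βz')²`. -/
theorem three_mul_sq_le_of_three_mul_sq_le {q α β ζ d k : ℝ} (hζ : 0 < ζ)
    (h : 3 * d ^ 2 ≤ 4 * ζ * k) :
    3 * (4 * q * α + 2 * β * d) ^ 2 ≤ 4 * (q ^ 2 + ζ) * (12 * α ^ 2 + 4 * β ^ 2 * k) := by
  have h1 := mul_le_mul_of_nonneg_left h (show 0 ≤ 4 * (q ^ 2 + ζ) * β ^ 2 by positivity)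
  refine le_of_mul_le_mul_left ?_ hζ
  nlinarith [sq_nonneg (2 * α * ζ - q * β * d)]

/-- `v(x,y,t) = ((x²+y²)² + z(t))^{1/4}` is H-convex iff
`4 z (1 + z'') ≥ 3 (z')²` on `ℝ`. -/
theorem stmt19 (z : ℝ → ℝ) (hz : ContDiff ℝ 2 z) (hzpos : ∀ t, 0 < z t) :
    HConvexOn Set.univ
        (fun g : Hgrp => ((g.1 ^ 2 + g.2.1 ^ 2) ^ 2 + z g.2.2) ^ ((1:ℝ)/4)) ↔
      ∀ t : ℝ, 4 * z t * (1 + deriv (deriv z) t) ≥ 3 * (deriv z t) ^ 2 := by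
  rw [hConvexOn_univ_iff_convexOn_lines]
  simp only [convexOn_line_iff hz hzpos]
  constructor
  · intro h t
    have hε : ∀ ε : ℝ, ε ≠ 0 →
        3 * deriv z t ^ 2 ≤ 4 * (ε ^ 4 + z t) * (1 + deriv (deriv z) t) := fun ε hε => by
      have h0 := h ε 0 t 0 1 0
      simp only [zero_mul, mul_zero, add_zero, mul_one, zero_add] at h0
      refine le_of_mul_le_mul_left ?_ (show 0 < 4 * ε ^ 2 by positivity)
      linarith
    have hc : Continuous fun ε : ℝ => 4 * (ε ^ 4 + z t) * (1 + deriv (deriv z) t) := by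
      fun_prop
    have hlim := (hc.tendsto 0).mono_left (nhdsWithin_le_nhds (s := {0}ᶜ))
    have := ge_of_tendsto hlim (eventually_nhdsWithin_of_forall hε)
    simpa using this
  · intro h x y t a b s
    exact three_mul_sq_le_of_three_mul_sq_le (hzpos _) (h _)
end
end
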